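/- arXiv:1410.1344 — 8 statements merged into one kernel-verified Lean document; each statement's English description precedes it below -/
import Mathlib

section
/- Let E be a Hausdorff semitopological semilattice and let L be a subsemilattice of E which is a chain with respect to the natural partial order (e ≤ f iff e*f = e), i.e. any two elements of L are comparable. Then the topological closure of L in E is again a subsemilattice of E which is a chain with respect to the natural partial order. In particular, every maximal chain of E is a closed subset of E. -/
open Topology

universe u v

/-- A semilattice: a commutative semigroup all of whose elements are idempotent. -/
def IsSemilatticeMul (E : Type u) [Mul E] : Prop :=
  (∀ x y z : E, x * y * z = x * (y * z)) ∧ (∀ x y : E, x * y = y * x) ∧ ∀ x : E, x * x = x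

/-- A (Hausdorff) semitopological semilattice: a semilattice with a Hausdorff topology
in which all translations are continuous. -/
def IsSemitopologicalSemilattice (E : Type u) [Mul E] [TopologicalSpace E] : Prop :=
  IsSemilatticeMul E ∧ T2Space E ∧ ∀ a : E, Continuous fun x : E => a * x

/-- A (Hausdorff) topological semilattice: a semilattice with a Hausdorff topology
in which the operation is jointly continuous. -/
def IsTopologicalSemilattice (E : Type u) [Mul E] [TopologicalSpace E] : Prop :=
  IsSemilatticeMul E ∧ T2Space E ∧ Continuous fun p : E × E => p.1 * p.2

/-- `E` is `H`-closed in the class of semitopological semilattices: the image of `E`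
under any homomorphic topological embedding into a semitopological semilattice is closed. -/
def HClosedInSemitopSemilattices (E : Type u) [Mul E] [TopologicalSpace E] : Prop :=
  ∀ (T : Type u) [Mul T] [TopologicalSpace T], IsSemitopologicalSemilattice T →
    ∀ f : E → T, (∀ x y : E, f (x * y) = f x * f y) → IsEmbedding f →
      IsClosed (Set.range f)

/-- In a semitopological semilattice the closure of a chain is a chain. -/
theorem IsSemitopologicalSemilattice.closure_chain {E : Type u} [Mul E] [TopologicalSpace E]
    (hE : IsSemitopologicalSemilattice E) {L : Set E}
    (hL : ∀ x ∈ L, ∀ y ∈ L, x * y = x ∨ x * y = y) :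
    ∀ x ∈ closure L, ∀ y ∈ closure L, x * y = x ∨ x * y = y := by
  obtain ⟨⟨-, hcomm, -⟩, hT2, hcont⟩ := hE
  have hclosed (a : E) : IsClosed {x : E | a * x = a ∨ a * x = x} :=
    (isClosed_eq (hcont a) continuous_const).union (isClosed_eq (hcont a) continuous_id)
  intro x hx y hy
  refine closure_minimal (fun b hb => ?_) (hclosed x) hy
  have hbx : b * x = b ∨ b * x = x := closure_minimal (hL b hb) (hclosed b) hx
  rw [hcomm b x] at hbx
  exact hbx.symm

/-- In a Hausdorff semitopological semilattice the closure of a chain subsemilattice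
(w.r.t. the natural order `x ≤ y ↔ x * y = x`) is again a chain subsemilattice;
in particular every maximal chain is closed. -/
theorem stmt8 {E : Type u} [Mul E] [TopologicalSpace E]
    (hE : IsSemitopologicalSemilattice E)
    (L : Set E) (hLmul : ∀ x ∈ L, ∀ y ∈ L, x * y ∈ L)
    (hLchain : ∀ x ∈ L, ∀ y ∈ L, x * y = x ∨ x * y = y) :
    ((∀ x ∈ closure L, ∀ y ∈ closure L, x * y ∈ closure L) ∧
        ∀ x ∈ closure L, ∀ y ∈ closure L, x * y = x ∨ x * y = y) ∧
      ∀ M : Set E,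
        ((∀ x ∈ M, ∀ y ∈ M, x * y = x ∨ x * y = y) ∧
            ∀ M' : Set E, (∀ x ∈ M', ∀ y ∈ M', x * y = x ∨ x * y = y) → M ⊆ M' →
              M' = M) →
          IsClosed M := by
  have hchain := hE.closure_chain hLchain
  refine ⟨⟨fun x hx y hy => ?_, hchain⟩, fun M hM => ?_⟩
  · rcases hchain x hx y hy with h | h <;> rwa [h]
  · exact closure_eq_iff_isClosed.mp (hM.2 _ (hE.closure_chain hM.1) subset_closure)
end

section
/- Every linearly ordered Hausdorff semitopological semilattice is a topological semilattice. That is, if E is a semilattice with a Hausdorff topology in which the operation is separately continuous and whose natural partial order (e ≤ f iff e*f = e) is a linear order, then the semilattice operation (x, y) ↦ x*y is jointly continuous on E × E. -/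
open Topology

universe u v

/-- In a linearly ordered semitopological semilattice, a strict inequality `x < y` persists
as a weak inequality on a neighbourhood of `(x, y)`. -/
theorem IsSemitopologicalSemilattice.eventually_mul_eq_fst {E : Type u} [Mul E]
    [TopologicalSpace E] (hE : IsSemitopologicalSemilattice E)
    (hlin : ∀ x y : E, x * y = x ∨ x * y = y) {x y : E} (hxy : x * y = x) (hne : x ≠ y) :
    ∀ᶠ p : E × E in 𝓝 (x, y), p.1 * p.2 = p.1 := by
  obtain ⟨⟨hassoc, hcomm, hidem⟩, hT2, hcont⟩ := hE
  have below (z : E) (hz : z * x ≠ z) : ∀ᶠ p : E × E in 𝓝 (x, y), z * p.1 = p.1 := by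
    have hopen : IsOpen {u : E | z * u ≠ z} := isOpen_ne_fun (hcont z) continuous_const
    filter_upwards [continuous_fst.continuousAt.eventually (hopen.mem_nhds hz)] with p hp
    exact (hlin z p.1).resolve_left hp
  have above (z : E) (hz : z * y ≠ y) :
      ∀ᶠ p : E × E in 𝓝 (x, y), z * p.2 = z ∧ p.2 ≠ z := by
    have hopen : IsOpen {v : E | z * v ≠ v} := isOpen_ne_fun (hcont z) continuous_id
    filter_upwards [continuous_snd.continuousAt.eventually (hopen.mem_nhds hz)] with p hp
    exact ⟨(hlin z p.2).resolve_right hp, fun h => hp (by rw [h, hidem])⟩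
  have trans {u z v : E} (hu : z * u = u) (hv : z * v = z) : u * v = u := by
    rw [← hu, hcomm z u, hassoc, hv]
  by_cases hz : ∃ z, x * z = x ∧ z ≠ x ∧ z * y = z ∧ z ≠ y
  · obtain ⟨z, hxz, hzx, hzy, hzy'⟩ := hz
    filter_upwards [below z (by rw [hcomm, hxz]; exact hzx.symm),
      above z (by rw [hzy]; exact hzy')] with p hu hv
    exact trans hu hv.1
  · filter_upwards [below y (by rw [hcomm, hxy]; exact hne),
      above x (by rw [hxy]; exact hne)] with p hu hv
    refine trans hu ((hlin y p.2).elim id fun h => ?_)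
    by_cases hpy : p.2 = y
    · rw [hpy, hidem]
    · exact (hz ⟨p.2, hv.1, hv.2, by rw [hcomm, h], hpy⟩).elim

/-- Every linearly ordered Hausdorff semitopological semilattice is a topological
semilattice: the operation is jointly continuous. -/
theorem stmt9 {E : Type u} [Mul E] [TopologicalSpace E]
    (hE : IsSemitopologicalSemilattice E)
    (hlin : ∀ x y : E, x * y = x ∨ x * y = y) :
    Continuous fun p : E × E => p.1 * p.2 := by
  have hcomm := hE.1.2.1
  refine continuous_iff_continuousAt.2 fun ⟨x, y⟩ => ?_
  by_cases hne : x = y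
  · subst hne
    intro W hW
    replace hW : W ∈ 𝓝 x := by simpa only [hE.1.2.2 x] using hW
    rw [Filter.mem_map]
    filter_upwards [(continuous_fst.tendsto (x, x)).eventually hW,
      (continuous_snd.tendsto (x, x)).eventually hW] with p hu hv
    rcases hlin p.1 p.2 with h | h
    · rwa [Set.mem_preimage, h]
    · rwa [Set.mem_preimage, h]
  · rcases hlin x y with h | h
    · exact continuous_fst.continuousAt.congr
        ((hE.eventually_mul_eq_fst hlin h hne).mono fun _ hp => hp.symm)
    · have hswap := (continuous_swap.tendsto (x, y)).eventually
        (hE.eventually_mul_eq_fst hlin (x := y) (y := x) (by rw [hcomm, h]) (Ne.symm hne))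
      refine continuous_snd.continuousAt.congr (hswap.mono fun p hp => ?_)
      exact ((hcomm p.1 p.2).trans hp).symm
end

section
/- A Hausdorff linearly ordered topological semilattice E is H-closed in the class of semitopological semilattices if and only if E is H-closed in the class of topological semilattices. That is: the image of E under any topological embedding of E into a semitopological semilattice which is also a semigroup homomorphism is closed, if and only if the image of E under any topological embedding of E into a topological semilattice which is also a semigroup homomorphism is closed. -/
open Topology

universe u v

/-- `E` is `H`-closed in the class of topological semilattices: the image of `E`
under any homomorphic topological embedding into a topological semilattice is closed. -/
def HClosedInTopSemilattices (E : Type u) [Mul E] [TopologicalSpace E] : Prop :=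
  ∀ (T : Type u) [Mul T] [TopologicalSpace T], IsTopologicalSemilattice T →
    ∀ f : E → T, (∀ x y : E, f (x * y) = f x * f y) → IsEmbedding f →
      IsClosed (Set.range f)

open Filter

/-- The set `E` together with one additional point, to which the filter `F` will converge. -/
inductive LimitExtension {E : Type u} (F : Filter E) : Type u
  | of (x : E)
  | lim

namespace LimitExtension

variable {E : Type u} {F : Filter E}

/-- The function representing a point modulo `F`: the new point is represented by the identity,
the points of `E` by constants. -/
def rep : LimitExtension F → E → E
  | of x, _ => x
  | lim, s => s

lemma of_injective : Function.Injective (of : E → LimitExtension F) := fun _ _ h => by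
  injection h

lemma eq_of_rep [F.NeBot] (hF : ∀ x, ¬ ∀ᶠ s in F, s = x) {a b : LimitExtension F}
    (h : ∀ᶠ s in F, rep a s = rep b s) : a = b := by
  rcases a with x | _ <;> rcases b with y | _
  · obtain ⟨_, hs⟩ := h.exists
    exact congrArg of hs
  · exact absurd (h.mono fun _ hs => hs.symm) (hF x)
  · exact absurd h (hF y)
  · rfl

section Mul

variable [Mul E]

open Classical in
/-- The multiplication making `rep` a homomorphism modulo `F`. -/
noncomputable instance : Mul (LimitExtension F) where
  mul
    | of x, of y => of (x * y)
    | of x, lim => if ∀ᶠ s in F, x * s = x then of x else lim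
    | lim, of x => if ∀ᶠ s in F, x * s = x then of x else lim
    | lim, lim => lim

lemma of_mul_of (x y : E) : (of x * of y : LimitExtension F) = of (x * y) := rfl

lemma lim_mul_lim : (lim * lim : LimitExtension F) = lim := rfl

lemma of_mul_lim {x : E} (h : ∀ᶠ s in F, x * s = x) :
    (of x * lim : LimitExtension F) = of x := if_pos h

lemma of_mul_lim_of_not {x : E} (h : ¬ ∀ᶠ s in F, x * s = x) :
    (of x * lim : LimitExtension F) = lim := if_neg h

lemma lim_mul_of (x : E) : (lim * of x : LimitExtension F) = of x * lim := rfl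

lemma mul_eq_or (hlin : ∀ x y : E, x * y = x ∨ x * y = y) (a b : LimitExtension F) :
    a * b = a ∨ a * b = b := by
  have key (x : E) : (of x * lim : LimitExtension F) = of x ∨
      (of x * lim : LimitExtension F) = lim := by
    by_cases h : ∀ᶠ s in F, x * s = x
    · exact Or.inl (of_mul_lim h)
    · exact Or.inr (of_mul_lim_of_not h)
  rcases a with x | _ <;> rcases b with y | _
  · rcases hlin x y with h | h <;> simp [of_mul_of, h]
  · exact key x
  · rw [lim_mul_of]
    exact (key y).symm
  · exact Or.inl rfl

lemma rep_mul (hE : IsSemilatticeMul E)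
    (hF : ∀ x, (∀ᶠ s in F, x * s = x) ∨ ∀ᶠ s in F, x * s = s) (a b : LimitExtension F) :
    ∀ᶠ s in F, rep (a * b) s = rep a s * rep b s := by
  have key (x : E) : ∀ᶠ s in F, rep (of x * lim : LimitExtension F) s = x * s := by
    by_cases h : ∀ᶠ s in F, x * s = x
    · rw [of_mul_lim h]
      exact h.mono fun s hs => hs.symm
    · rw [of_mul_lim_of_not h]
      exact ((hF x).resolve_left h).mono fun s hs => hs.symm
  rcases a with x | _ <;> rcases b with y | _
  · exact Eventually.of_forall fun _ => rfl
  · exact key x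
  · rw [lim_mul_of]
    exact (key y).mono fun s hs => hs.trans (hE.2.1 _ _)
  · exact Eventually.of_forall fun s => (hE.2.2 s).symm

lemma isSemilatticeMul [F.NeBot] (hE : IsSemilatticeMul E)
    (hF : ∀ x, (∀ᶠ s in F, x * s = x) ∨ ∀ᶠ s in F, x * s = s)
    (hF' : ∀ x, ¬ ∀ᶠ s in F, s = x) : IsSemilatticeMul (LimitExtension F) := by
  refine ⟨fun a b c => eq_of_rep hF' ?_, fun a b => eq_of_rep hF' ?_, fun a => eq_of_rep hF' ?_⟩
  · filter_upwards [rep_mul hE hF (a * b) c, rep_mul hE hF a b, rep_mul hE hF a (b * c),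
      rep_mul hE hF b c] with s h₁ h₂ h₃ h₄
    rw [h₁, h₂, h₃, h₄, hE.1]
  · filter_upwards [rep_mul hE hF a b, rep_mul hE hF b a] with s h₁ h₂
    rw [h₁, h₂, hE.2.1]
  · filter_upwards [rep_mul hE hF a a] with s h
    rw [h, hE.2.2]

end Mul

section Topology

variable [TopologicalSpace E]

instance : TopologicalSpace (LimitExtension F) where
  IsOpen s := IsOpen (of ⁻¹' s) ∧ (lim ∈ s → of ⁻¹' s ∈ F)
  isOpen_univ := ⟨isOpen_univ, fun _ => univ_mem⟩
  isOpen_inter s t hs ht :=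
    ⟨hs.1.inter ht.1, fun h => inter_mem (hs.2 h.1) (ht.2 h.2)⟩
  isOpen_sUnion S hS := by
    refine ⟨?_, ?_⟩
    · rw [Set.preimage_sUnion]
      exact isOpen_biUnion fun s hs => (hS s hs).1
    · rintro ⟨s, hs, h⟩
      exact mem_of_superset ((hS s hs).2 h) (Set.preimage_mono (Set.subset_sUnion_of_mem hs))

lemma isOpen_def {s : Set (LimitExtension F)} :
    IsOpen s ↔ IsOpen (of ⁻¹' s) ∧ (lim ∈ s → of ⁻¹' s ∈ F) := Iff.rfl

lemma isOpenEmbedding_of : IsOpenEmbedding (of : E → LimitExtension F) := by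
  refine .of_continuous_injective_isOpenMap
    (continuous_def.2 fun s hs => (isOpen_def.1 hs).1) of_injective fun s hs => ?_
  rw [isOpen_def, Set.preimage_image_eq _ of_injective]
  exact ⟨hs, by simp⟩

lemma nhds_of (x : E) : 𝓝 (of x : LimitExtension F) = map of (𝓝 x) :=
  (isOpenEmbedding_of.map_nhds_eq x).symm

lemma nhds_lim (hF : ∀ s ∈ F, ∃ t ∈ F, t ⊆ s ∧ IsOpen t) :
    𝓝 (lim : LimitExtension F) = pure lim ⊔ map of F := by
  refine le_antisymm (fun s hs => ?_) (sup_le (pure_le_nhds _) fun s hs => ?_)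
  · obtain ⟨h₁, h₂⟩ := mem_sup.1 hs
    obtain ⟨t, ht, hts, hto⟩ := hF _ (mem_map.1 h₂)
    refine mem_nhds_iff.2 ⟨insert lim (of '' t), ?_, ?_, Set.mem_insert _ _⟩
    · exact Set.insert_subset (mem_pure.1 h₁) (Set.image_subset_iff.2 hts)
    · have : of ⁻¹' (insert lim (of '' t) : Set (LimitExtension F)) = t := by
        ext x
        simp
      rw [isOpen_def, this]
      exact ⟨hto, fun _ => ht⟩
  · obtain ⟨t, hts, hto, ht⟩ := mem_nhds_iff.1 hs
    exact mem_map.2 (mem_of_superset (hto.2 ht) (Set.preimage_mono hts))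

lemma t2Space [T2Space E] (hF : ∀ s ∈ F, ∃ t ∈ F, t ⊆ s ∧ IsOpen t)
    (hdisj : ∀ x, Disjoint (𝓝 x) F) : T2Space (LimitExtension F) := by
  have key (x : E) : Disjoint (𝓝 (of x : LimitExtension F)) (𝓝 lim) := by
    rw [nhds_of, nhds_lim hF, disjoint_sup_right, disjoint_map of_injective]
    refine ⟨?_, hdisj x⟩
    rw [← principal_singleton]
    exact disjoint_principal_right.2 (mem_map.2 (Eventually.of_forall fun y => by simp))
  refine t2Space_iff_disjoint_nhds.2 fun a b hab => ?_
  rcases a with x | _ <;> rcases b with y | _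
  · rw [nhds_of, nhds_of, disjoint_map of_injective]
    exact disjoint_nhds_nhds.2 fun h => hab (congrArg of h)
  · exact key x
  · exact (key y).symm
  · exact absurd rfl hab

lemma continuous_mul [Mul E] (hcont : Continuous fun p : E × E => p.1 * p.2)
    (hlin : ∀ x y : E, x * y = x ∨ x * y = y)
    (hcomm : ∀ a b : LimitExtension F, a * b = b * a)
    (hF : ∀ s ∈ F, ∃ t ∈ F, t ⊆ s ∧ IsOpen t)
    (hcut : ∀ x, (∀ᶠ q in 𝓝 x ×ˢ F, q.1 * q.2 = q.1) ∨
      ((∀ᶠ q in 𝓝 x ×ˢ F, q.1 * q.2 = q.2) ∧ ∀ᶠ v in 𝓝 x, ¬ ∀ᶠ s in F, v * s = v)) :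
    Continuous fun p : LimitExtension F × LimitExtension F => p.1 * p.2 := by
  have key (x : E) : Tendsto (fun p : LimitExtension F × LimitExtension F => p.1 * p.2)
      (𝓝 (of x) ×ˢ 𝓝 lim) (𝓝 (of x * lim)) := by
    have hlim : 𝓝 (lim : LimitExtension F) = pure lim ⊔ map of F := nhds_lim hF
    have hto : Tendsto of F (𝓝 (lim : LimitExtension F)) := by
      rw [hlim]
      exact le_sup_right
    have hof : Tendsto of (𝓝 x) (𝓝 (of x : LimitExtension F)) := (nhds_of x).ge
    rw [hlim, prod_sup, tendsto_sup, nhds_of, prod_pure, map_map, tendsto_map'_iff,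
      prod_map_map_eq, tendsto_map'_iff]
    rcases hcut x with h | ⟨h, h'⟩
    · rw [of_mul_lim h.curry.self_of_nhds]
      refine ⟨hof.congr' ?_, (hof.comp tendsto_fst).congr' ?_⟩
      · exact h.curry.mono fun v hv => (of_mul_lim hv).symm
      · exact h.mono fun q hq => congrArg of hq.symm
    · rw [of_mul_lim_of_not h'.self_of_nhds]
      refine ⟨tendsto_nhds_of_eventually_eq ?_, (hto.comp tendsto_snd).congr' ?_⟩
      · exact h'.mono fun v hv => of_mul_lim_of_not hv
      · exact h.mono fun q hq => congrArg of hq.symm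
  refine continuous_iff_continuousAt.2 fun ⟨a, b⟩ => ?_
  rw [ContinuousAt, nhds_prod_eq]
  rcases a with x | _ <;> rcases b with y | _
  · rw [nhds_of, nhds_of, prod_map_map_eq, tendsto_map'_iff, ← nhds_prod_eq]
    exact (isOpenEmbedding_of.continuous.comp hcont).tendsto (x, y)
  · exact key x
  · rw [prod_comm, tendsto_map'_iff]
    exact (key y).congr fun p => hcomm _ _
  · intro s hs
    refine mem_map.2 (mem_of_superset (prod_mem_prod hs hs) fun p hp => ?_)
    rcases mul_eq_or hlin p.1 p.2 with h | h <;> simp [h, hp.1, hp.2]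

end Topology

end LimitExtension

/-- In a linearly ordered topological semilattice which is `H`-closed among topological
semilattices, an open filter which determines a cut has a cluster point. -/
lemma HClosedInTopSemilattices.exists_not_disjoint {E : Type u} [Mul E] [TopologicalSpace E]
    (h : HClosedInTopSemilattices E) (hE : IsTopologicalSemilattice E)
    (hlin : ∀ x y : E, x * y = x ∨ x * y = y) (F : Filter E) [F.NeBot]
    (hF : ∀ s ∈ F, ∃ t ∈ F, t ⊆ s ∧ IsOpen t)
    (hcut : ∀ x, (∀ᶠ q in 𝓝 x ×ˢ F, q.1 * q.2 = q.1) ∨ ∀ᶠ q in 𝓝 x ×ˢ F, q.1 * q.2 = q.2) :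
    ∃ x, ¬ Disjoint (𝓝 x) F := by
  by_contra! hdisj
  have hne (x : E) : ¬ ∀ᶠ s in F, s = x := fun hx =>
    have hle : F ≤ 𝓝 x := fun s hs => hx.mono fun y hy => hy ▸ mem_of_mem_nhds hs
    NeBot.ne ‹F.NeBot› ((hdisj x).symm.eq_bot_of_le hle)
  have := hE.2.1
  have hmul : IsSemilatticeMul (LimitExtension F) :=
    LimitExtension.isSemilatticeMul hE.1
      (fun x => (hcut x).imp (fun hx => hx.curry.self_of_nhds) fun hx => hx.curry.self_of_nhds) hne
  have hcont := LimitExtension.continuous_mul hE.2.2 hlin hmul.2.1 hF fun x =>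
    (hcut x).imp_right fun hx => ⟨hx, hx.curry.mono fun v hv hv' =>
      hne v ((hv.and hv').mono fun s hs => hs.1.symm.trans hs.2)⟩
  have hclosed := h (LimitExtension F) ⟨hmul, LimitExtension.t2Space hF hdisj, hcont⟩
    LimitExtension.of (fun _ _ => rfl) LimitExtension.isOpenEmbedding_of.isEmbedding
  have hmem : LimitExtension.lim ∈ Set.range (LimitExtension.of : E → LimitExtension F) := by
    refine hclosed.mem_of_tendsto (b := F) (f := LimitExtension.of) ?_
      (Eventually.of_forall fun x => Set.mem_range_self x)
    rw [LimitExtension.nhds_lim hF]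
    exact le_sup_right
  simp at hmem

/-- A Hausdorff linearly ordered topological semilattice is `H`-closed in the class
of semitopological semilattices iff it is `H`-closed in the class of topological
semilattices. -/
theorem stmt10 {E : Type u} [Mul E] [TopologicalSpace E]
    (hE : IsTopologicalSemilattice E)
    (hlin : ∀ x y : E, x * y = x ∨ x * y = y) :
    HClosedInSemitopSemilattices E ↔ HClosedInTopSemilattices E := by
  refine ⟨fun h T _ _ hT f hf hfe => h T ⟨hT.1, hT.2.1, fun a => ?_⟩ f hf hfe,
    fun h T _ _ hT f hf hfe => ?_⟩
  · exact hT.2.2.comp (by fun_prop : Continuous fun x : T => (a, x))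
  have := hT.2.1
  have := hE.2.1
  obtain ⟨⟨hassoc, hcomm, hidem⟩, -, hcont⟩ := hE
  have hcontR (a : E) : Continuous fun x : E => x * a :=
    hcont.comp (by fun_prop : Continuous fun x : E => (x, a))
  have hTR (a : T) : Continuous fun x : T => x * a :=
    (hT.2.2 a).congr fun x => hT.1.2.1 a x
  refine isClosed_of_closure_subset fun t ht => ?_
  by_contra hnot
  have hne (e : E) : t ≠ f e := fun h => hnot ⟨e, h.symm⟩
  have hcases (e : E) : t * f e = t ∨ t * f e = f e := by
    have hcl : IsClosed {y : T | y * f e = y ∨ y * f e = f e} :=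
      (isClosed_eq (hTR _) continuous_id).union (isClosed_eq (hTR _) continuous_const)
    refine closure_minimal ?_ hcl ht
    rintro _ ⟨x, rfl⟩
    exact (hlin x e).imp (fun h => by rw [← hf, h]) fun h => by rw [← hf, h]
  set L : Set E := {e | t * f e = f e}
  have hLc : Lᶜ = {e | t * f e = t} := by
    ext e
    constructor
    · exact fun h => (hcases e).resolve_right h
    · exact fun h h' => hne e (h.symm.trans h')
  have hLclosed : IsClosed L := isClosed_eq ((hT.2.2 t).comp hfe.continuous) hfe.continuous
  have hLopen : IsOpen L := by
    rw [← isClosed_compl_iff, hLc]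
    exact isClosed_eq ((hT.2.2 t).comp hfe.continuous) continuous_const
  have hLU {v s : E} (hv : v ∈ L) (hs : s ∈ Lᶜ) : v * s = v := by
    rw [hLc] at hs
    refine hfe.injective ?_
    rw [hf, ← hv, hT.1.2.1 t, hT.1.1, hs]
  have hcontra (A : Set E) (hA : IsOpen A) (htA : t ∈ closure (f '' A))
      (hcut : ∀ x, (∀ᶠ q in 𝓝 x ×ˢ (comap f (𝓝 t) ⊓ 𝓟 A), q.1 * q.2 = q.1) ∨
        ∀ᶠ q in 𝓝 x ×ˢ (comap f (𝓝 t) ⊓ 𝓟 A), q.1 * q.2 = q.2) : False := by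
    have : (comap f (𝓝 t) ⊓ 𝓟 A).NeBot := by
      rw [← map_neBot_iff f, Filter.push_pull', map_principal]
      exact mem_closure_iff_nhdsWithin_neBot.1 htA
    have hopen : ∀ s ∈ comap f (𝓝 t) ⊓ 𝓟 A, ∃ u ∈ comap f (𝓝 t) ⊓ 𝓟 A, u ⊆ s ∧ IsOpen u := by
      intro s hs
      obtain ⟨u, hu, hus⟩ := mem_comap.1 (mem_inf_principal.1 hs)
      obtain ⟨v, hvu, hv, htv⟩ := mem_nhds_iff.1 hu
      exact ⟨f ⁻¹' v ∩ A, inter_mem_inf (preimage_mem_comap (hv.mem_nhds htv))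
        (mem_principal_self A), fun x hx => hus (hvu hx.1) hx.2,
        (hv.preimage hfe.continuous).inter hA⟩
    obtain ⟨x, hx⟩ :=
      h.exists_not_disjoint ⟨⟨hassoc, hcomm, hidem⟩, ‹_›, hcont⟩ hlin _ hopen hcut
    refine hx (Disjoint.mono_right inf_le_left ?_)
    rw [hfe.nhds_eq_comap]
    exact disjoint_comap (disjoint_nhds_nhds.2 (hne x).symm)
  have hfilter {A : Set E} : A ∈ comap f (𝓝 t) ⊓ 𝓟 A :=
    mem_inf_of_right (mem_principal_self A)
  have hunion : t ∈ closure (f '' L) ∪ closure (f '' Lᶜ) := by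
    rw [← closure_union, ← Set.image_union, Set.union_compl_self, Set.image_univ]
    exact ht
  rcases hunion with htL | htU
  · refine hcontra L hLopen htL fun p => ?_
    by_cases hp : p ∈ L
    · left
      obtain ⟨x, hx, hxp⟩ : ∃ x ∈ L, x * p ≠ x := by
        by_contra! hmax
        have hcl : IsClosed {y : T | y * f p = y} := isClosed_eq (hTR _) continuous_id
        have : t * f p = t := by
          refine closure_minimal ?_ hcl htL
          rintro _ ⟨x, hx, rfl⟩
          exact (hf _ _).symm.trans (congrArg f (hmax x hx))
        exact hne p (this.symm.trans hp)
      have hV : ∀ᶠ v in 𝓝 p, v * x ≠ x :=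
        (isOpen_ne_fun (hcontR x) continuous_const).mem_nhds (by rwa [Set.mem_ofPred, hcomm])
      have hS : ∀ᶠ s in comap f (𝓝 t) ⊓ 𝓟 L, s * x ≠ s := by
        have : ∀ᶠ y in 𝓝 t, y * f x ≠ y :=
          (isOpen_ne_fun (hTR _) continuous_id).mem_nhds fun h' => hne x (h'.symm.trans hx)
        refine Eventually.filter_mono inf_le_left ((this.comap f).mono fun s hs h' => hs ?_)
        rw [← hf, h']
      filter_upwards [prod_mem_prod hV hS] with ⟨v, s⟩ ⟨hv, hs⟩
      have hv' := (hlin v x).resolve_right hv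
      have hs' := (hlin s x).resolve_left hs
      calc v * s = v * x * s := by rw [hv']
        _ = v * (s * x) := by rw [hassoc, hcomm x]
        _ = v := by rw [hs', hv']
    · right
      filter_upwards [prod_mem_prod (hLclosed.isOpen_compl.mem_nhds hp) hfilter]
        with ⟨v, s⟩ ⟨hv, hs⟩
      rw [hcomm]
      exact hLU hs hv
  · refine hcontra Lᶜ hLclosed.isOpen_compl htU fun p => ?_
    by_cases hp : p ∈ L
    · left
      filter_upwards [prod_mem_prod (hLopen.mem_nhds hp) hfilter] with ⟨v, s⟩ ⟨hv, hs⟩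
      exact hLU hv hs
    · right
      have hpt : t * f p = t := (hcases p).resolve_right hp
      obtain ⟨x, hx, hxp⟩ : ∃ x ∈ Lᶜ, x * p ≠ p := by
        by_contra! hmin
        have hcl : IsClosed {y : T | y * f p = f p} := isClosed_eq (hTR _) continuous_const
        refine hp (closure_minimal ?_ hcl htU)
        rintro _ ⟨x, hx, rfl⟩
        exact (hf _ _).symm.trans (congrArg f (hmin x hx))
      have hV : ∀ᶠ v in 𝓝 p, v * x ≠ v :=
        (isOpen_ne_fun (hcontR x) continuous_id).mem_nhds
          (by rwa [Set.mem_ofPred, hcomm])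
      have hS : ∀ᶠ s in comap f (𝓝 t) ⊓ 𝓟 Lᶜ, s * x ≠ x := by
        have : ∀ᶠ y in 𝓝 t, y * f x ≠ f x :=
          (isOpen_ne_fun (hTR _) continuous_const).mem_nhds hx
        refine Eventually.filter_mono inf_le_left ((this.comap f).mono fun s hs h' => hs ?_)
        rw [← hf, h']
      filter_upwards [prod_mem_prod hV hS] with ⟨v, s⟩ ⟨hv, hs⟩
      have hv' := (hlin v x).resolve_left hv
      have hs' := (hlin s x).resolve_right hs
      calc v * s = s * x * v := by rw [hs', hcomm]
        _ = s * (v * x) := by rw [hassoc, hcomm x]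
        _ = s := by rw [hv', hs']
end

section
/- A linearly ordered semitopological semilattice E is H-closed in the class of semitopological semilattices if and only if the following three conditions hold: (i) E is complete, i.e. every non-empty subset of E has an infimum and a supremum in E; (ii) whenever A is a non-empty subset of E with A = ↓A \ {x} (A is downward closed except for x) and x = sup A, then x lies in the topological closure of A; (iii) whenever B is a non-empty subset of E with B = ↑B \ {x} (B is upward closed except for x) and x = inf B, then x lies in the topological closure of B. -/
open Topology

universe u v

/-- Order form of `H`-closedness: monotone topological embeddings of `E` into Hausdorff linearly
ordered spaces with closed principal ideals and filters have closed range. -/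
def IsOrderHClosed (E : Type u) [LinearOrder E] [TopologicalSpace E] : Prop :=
  ∀ (T : Type u) [LinearOrder T] [TopologicalSpace T] [T2Space T] [ClosedIicTopology T]
    [ClosedIciTopology T] (f : E → T), Monotone f → IsEmbedding f → IsClosed (Set.range f)

/-- The linear order obtained from `E` by inserting one point just above the lower set `L`. -/
def CutExtension {E : Type u} [LinearOrder E] (_L : LowerSet E) : Type u := Option E

namespace CutExtension

variable {E : Type u} [LinearOrder E] {L : LowerSet E}

/-- The inclusion of `E` into its extension. -/
def of (L : LowerSet E) (e : E) : CutExtension L := some e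

/-- The inserted point. -/
def cut (L : LowerSet E) : CutExtension L := none

theorem of_injective : Function.Injective (of L) := Option.some_injective E

theorem of_ne_cut (e : E) : of L e ≠ cut L := Option.some_ne_none e

theorem eq_of_or_eq_cut (s : CutExtension L) : (∃ e, s = of L e) ∨ s = cut L := by
  cases s with
  | none => exact .inr rfl
  | some e => exact .inl ⟨e, rfl⟩

/-- The comparison on `CutExtension L`. -/
def Le : CutExtension L → CutExtension L → Prop
  | none, none => True
  | none, some e => e ∉ L
  | some e, none => e ∈ L
  | some e, some e' => e ≤ e'

noncomputable instance : LinearOrder (CutExtension L) where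
  le := Le
  le_refl := by rintro (_ | a) <;> simp [Le]
  le_trans
    | none, none, _, _, h => h
    | none, some _, none, _, _ => trivial
    | none, some _, some _, hab, hbc => fun hc => hab (L.lower hbc hc)
    | some _, none, none, hab, _ => hab
    | some _, none, some _, hab, hbc => le_of_not_ge fun hca => hbc (L.lower hca hab)
    | some _, some _, none, hab, hbc => L.lower hab hbc
    | some _, some _, some _, hab, hbc => le_trans (α := E) hab hbc
  le_antisymm
    | none, none, _, _ => rfl
    | none, some _, hab, hba => absurd hba hab
    | some _, none, hab, hba => absurd hab hba
    | some _, some _, hab, hba => congrArg some (le_antisymm (α := E) hab hba)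
  le_total := by
    rintro (_ | a) (_ | b) <;> simp only [Le, or_self]
    · exact (em _).symm
    · exact em _
    · exact le_total a b
  toDecidableLE := Classical.decRel _

@[simp] theorem of_le_of {a b : E} : of L a ≤ of L b ↔ a ≤ b := Iff.rfl

@[simp] theorem of_lt_of {a b : E} : of L a < of L b ↔ a < b := by
  simp only [← not_le, of_le_of]

@[simp] theorem of_lt_cut {a : E} : of L a < cut L ↔ a ∈ L :=
  not_le.symm.trans (not_not (a := a ∈ L))

@[simp] theorem cut_lt_of {a : E} : cut L < of L a ↔ a ∉ L :=
  not_le.symm.trans (Iff.refl (a ∉ L))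

variable [TopologicalSpace E]

instance : TopologicalSpace (CutExtension L) where
  IsOpen U := IsOpen (of L ⁻¹' U) ∧ (cut L ∈ U → ∀ᶠ b : L in Filter.atTop, of L b ∈ U)
  isOpen_univ := by simp
  isOpen_inter U V hU hV :=
    ⟨hU.1.inter hV.1, fun h => (hU.2 h.1).and (hV.2 h.2)⟩
  isOpen_sUnion S hS := by
    refine ⟨?_, ?_⟩
    · rw [Set.preimage_sUnion]
      exact isOpen_biUnion fun U hU => (hS U hU).1
    · rintro ⟨U, hU, hc⟩
      exact ((hS U hU).2 hc).mono fun b hb => ⟨U, hU, hb⟩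

theorem isOpen_iff {U : Set (CutExtension L)} :
    IsOpen U ↔ IsOpen (of L ⁻¹' U) ∧ (cut L ∈ U → ∀ᶠ b : L in Filter.atTop, of L b ∈ U) :=
  Iff.rfl

theorem isOpenEmbedding_of : IsOpenEmbedding (of L) := by
  refine .of_continuous_injective_isOpenMap ⟨fun U hU => (isOpen_iff.1 hU).1⟩ of_injective
    fun U hU => isOpen_iff.2 ⟨?_, ?_⟩
  · rwa [Set.preimage_image_eq _ of_injective]
  · rintro ⟨e, -, he⟩
    exact absurd he (of_ne_cut e)

theorem not_isClosed_range_of [Nonempty L] : ¬ IsClosed (Set.range (of L)) := by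
  intro h
  have hc : cut L ∈ (Set.range (of L))ᶜ := fun ⟨e, he⟩ => of_ne_cut e he
  obtain ⟨b, hb⟩ := ((isOpen_iff.1 h.isOpen_compl).2 hc).exists
  exact hb ⟨b, rfl⟩

theorem isOpen_Iio [ClosedIciTopology E] (hL : IsClopen (L : Set E)) (s : CutExtension L) :
    IsOpen (Set.Iio s) := by
  rcases eq_of_or_eq_cut s with ⟨e, rfl⟩ | rfl <;> refine isOpen_iff.2 ⟨?_, ?_⟩
  · convert _root_.isOpen_Iio (a := e) using 1
    ext; simp
  · exact fun h => .of_forall fun b => (of_lt_cut.2 b.2).trans h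
  · convert hL.isOpen using 1
    ext; simp
  · exact fun h => (lt_irrefl _ (Set.mem_Iio.1 h)).elim

theorem isOpen_Ioi [ClosedIicTopology E] [Nonempty L] [NoMaxOrder L] (hL : IsClopen (L : Set E))
    (s : CutExtension L) : IsOpen (Set.Ioi s) := by
  rcases eq_of_or_eq_cut s with ⟨e, rfl⟩ | rfl <;> refine isOpen_iff.2 ⟨?_, ?_⟩
  · convert _root_.isOpen_Ioi (a := e) using 1
    ext; simp
  · intro h
    exact (Filter.eventually_gt_atTop (⟨e, of_lt_cut.1 h⟩ : L)).mono fun b hb => of_lt_of.2 hb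
  · convert hL.compl.isOpen using 1
    ext; simp
  · exact fun h => (lt_irrefl _ (Set.mem_Ioi.1 h)).elim

theorem closedIciTopology [ClosedIciTopology E] (hL : IsClopen (L : Set E)) :
    ClosedIciTopology (CutExtension L) :=
  ⟨fun s => by rw [← isOpen_compl_iff, Set.compl_Ici]; exact isOpen_Iio hL s⟩

theorem closedIicTopology [ClosedIicTopology E] [Nonempty L] [NoMaxOrder L]
    (hL : IsClopen (L : Set E)) :
    ClosedIicTopology (CutExtension L) :=
  ⟨fun s => by rw [← isOpen_compl_iff, Set.compl_Iic]; exact isOpen_Ioi hL s⟩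

theorem t2Space [T2Space E] [ClosedIicTopology E] [ClosedIciTopology E] [Nonempty L]
    [NoMaxOrder L] (hL : IsClopen (L : Set E)) :
    T2Space (CutExtension L) := by
  have key (e : E) : SeparatedNhds {of L e} {cut L} := by
    by_cases he : e ∈ L
    · obtain ⟨b, hb⟩ := exists_gt (⟨e, he⟩ : L)
      exact ⟨_, _, isOpen_Iio hL (of L b), isOpen_Ioi hL (of L b), by
        simpa using Subtype.coe_lt_coe.2 hb, by simp,
        Set.disjoint_left.2 fun _ h h' => lt_asymm (Set.mem_Iio.1 h) h'⟩
    · refine ⟨Set.Ioi (cut L), Set.Iic (cut L), isOpen_Ioi hL _, isOpen_iff.2 ⟨?_, fun _ => ?_⟩,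
        by simpa using he, by simp,
        Set.disjoint_left.2 fun _ h h' => not_lt_of_ge (Set.mem_Iic.1 h') h⟩
      · convert hL.isOpen using 1
        ext a
        exact Iff.refl (a ∈ L)
      · exact .of_forall fun b => (of_lt_cut.2 b.2).le
  refine t2Space_iff_disjoint_nhds.2 fun s t hst => ?_
  beta_reduce
  rw [← nhdsSet_singleton, ← nhdsSet_singleton, ← separatedNhds_iff_disjoint]
  rcases eq_of_or_eq_cut s with ⟨e, rfl⟩ | rfl <;> rcases eq_of_or_eq_cut t with ⟨e', rfl⟩ | rfl
  · obtain ⟨U, V, hU, hV, heU, heV, hd⟩ := t2_separation (ne_of_apply_ne _ hst)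
    exact ⟨_, _, isOpenEmbedding_of.isOpenMap U hU, isOpenEmbedding_of.isOpenMap V hV,
      by simpa using ⟨e, heU, rfl⟩, by simpa using ⟨e', heV, rfl⟩,
      (Set.disjoint_image_iff of_injective).2 hd⟩
  · exact key e
  · exact (key e').symm
  · exact absurd rfl hst

end CutExtension

namespace IsOrderHClosed

variable {E : Type u} [LinearOrder E] [TopologicalSpace E]

theorem dual (h : IsOrderHClosed E) : IsOrderHClosed Eᵒᵈ := by
  intro T _ _ _ _ _ f hf hemb
  have : T2Space Tᵒᵈ := inferInstanceAs (T2Space T)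
  exact h Tᵒᵈ (fun e => OrderDual.toDual (f (OrderDual.toDual e))) (fun _ _ hab => hf hab) hemb

variable [T2Space E] [ClosedIicTopology E] [ClosedIciTopology E]

theorem exists_isGreatest_of_isClopen (h : IsOrderHClosed E) {L : Set E} (hL : IsClopen L)
    (hlow : IsLowerSet L) (hne : L.Nonempty) : ∃ m, IsGreatest L m := by
  by_contra! hmax
  let L' : LowerSet E := ⟨L, hlow⟩
  have hL' : IsClopen (L' : Set E) := hL
  have : Nonempty L' := hne.to_subtype
  have : NoMaxOrder L' := ⟨fun ⟨a, ha⟩ => by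
    by_contra! hb
    exact hmax a ⟨ha, fun b hbL => hb ⟨b, hbL⟩⟩⟩
  have := CutExtension.t2Space hL'
  have := CutExtension.closedIicTopology hL'
  have := CutExtension.closedIciTopology hL'
  exact CutExtension.not_isClosed_range_of (L := L')
    (h _ _ (fun _ _ hab => CutExtension.of_le_of.2 hab)
      CutExtension.isOpenEmbedding_of.isEmbedding)

theorem exists_isLUB (h : IsOrderHClosed E) {A : Set E} (hA : A.Nonempty) :
    ∃ s, IsLUB A s := by
  by_contra! hlub
  obtain ⟨a, ha⟩ := hA
  have hopen : IsOpen (upperBounds A)ᶜ := by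
    rw [isOpen_compl_iff, upperBounds, Set.ofPred_forall]
    refine isClosed_iInter fun b => ?_
    rw [Set.ofPred_forall]
    exact isClosed_iInter fun _ => isClosed_Ici
  have hclosed : IsClosed (upperBounds A)ᶜ := by
    rw [isClosed_compl_iff]
    have : upperBounds A = ⋃ u ∈ upperBounds A, Set.Ioi u := by
      ext u
      simp only [Set.mem_iUnion, Set.mem_Ioi, exists_prop]
      refine ⟨fun hu => ?_, fun ⟨v, hv, hvu⟩ b hb => (hv hb).trans hvu.le⟩
      by_contra! hmin
      exact hlub u ⟨hu, hmin⟩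
    rw [this]
    exact isOpen_biUnion fun _ _ => isOpen_Ioi
  have hmem {b : E} (hb : b ∈ A) : b ∈ (upperBounds A)ᶜ := fun hub =>
    hlub b ⟨hub, fun _ hc => hc hb⟩
  obtain ⟨m, hm, hmax⟩ := h.exists_isGreatest_of_isClopen ⟨hclosed, hopen⟩
    (fun b c hcb hb hc => hb fun d hd => (hc hd).trans hcb) ⟨a, hmem ha⟩
  exact hm fun b hb => hmax (hmem hb)

theorem mem_closure_of_isLUB (h : IsOrderHClosed E) {A : Set E} {x : E} (hne : A.Nonempty)
    (hA : A = {y | ∃ a ∈ A, y ≤ a} \ {x}) (hx : IsLUB A x) : x ∈ closure A := by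
  have hxA : x ∉ A := fun hmem => (hA.subset hmem).2 rfl
  have hIio : A = Set.Iio x := by
    ext y
    refine ⟨fun hy => lt_of_le_of_ne (hx.1 hy) fun hyx => hxA (hyx ▸ hy), fun hy => ?_⟩
    obtain ⟨a, ha, hya⟩ := (lt_isLUB_iff hx).1 hy
    exact hA.superset ⟨⟨a, ha, hya.le⟩, (show y < x from hy).ne⟩
  subst hIio
  by_contra hcl
  have hclosed : IsClosed (Set.Iio x) := isClosed_of_closure_subset fun y hy =>
    lt_of_le_of_ne (closure_minimal Set.Iio_subset_Iic_self isClosed_Iic hy)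
      fun hyx => hcl (hyx ▸ hy)
  obtain ⟨m, hm⟩ := h.exists_isGreatest_of_isClopen ⟨hclosed, isOpen_Iio⟩ (isLowerSet_Iio x) hne
  exact hxA (hx.unique hm.isLUB ▸ hm.1)

end IsOrderHClosed

/-- The natural linear order of a linearly ordered semilattice. -/
noncomputable abbrev IsSemilatticeMul.linearOrder {E : Type u} [Mul E] (hE : IsSemilatticeMul E)
    (hlin : ∀ x y : E, x * y = x ∨ x * y = y) : LinearOrder E where
  le x y := x * y = x
  le_refl := hE.2.2
  le_trans x y z hxy hyz := by rw [← hxy, hE.1, hyz]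
  le_antisymm x y hxy hyx := by rw [← hxy, hE.2.1, hyx]
  le_total x y := (hlin x y).imp_right fun h => by rw [hE.2.1, h]
  toDecidableLE := Classical.decRel _

theorem continuous_min_left {T : Type u} [LinearOrder T] [TopologicalSpace T]
    [ClosedIicTopology T] [ClosedIciTopology T] (a : T) : Continuous fun x => min a x := by
  rw [← continuousOn_univ, ← Set.Iic_union_Ici (a := a)]
  refine ContinuousOn.union_of_isClosed ?_ ?_ isClosed_Iic isClosed_Ici
  · exact continuousOn_id.congr fun x hx => min_eq_right hx
  · exact continuousOn_const.congr fun x hx => min_eq_left hx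

theorem HClosedInSemitopSemilattices.isOrderHClosed {E : Type u} [Mul E] [LinearOrder E]
    [TopologicalSpace E] (h : HClosedInSemitopSemilattices E)
    (hmul : ∀ x y : E, x * y = min x y) : IsOrderHClosed E := by
  intro T _ _ _ _ _ f hf hemb
  let : Mul T := ⟨min⟩
  refine h T ⟨⟨min_assoc, min_comm, min_self⟩, inferInstance, continuous_min_left⟩ f ?_ hemb
  intro x y
  rw [hmul]
  exact hf.map_min

theorem mul_eq_left_of_mem_closure {T : Type u} [Mul T] [TopologicalSpace T]
    (hT : IsSemitopologicalSemilattice T) {s : Set T} {t c : T} (ht : t ∈ closure s)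
    (h : ∀ x ∈ s, x * c = x) : t * c = t := by
  have := hT.2.1
  simp only [hT.1.2.1 _ c] at h ⊢
  exact closure_minimal (t := {x | c * x = x}) h (isClosed_eq (hT.2.2 c) continuous_id) ht

theorem mul_eq_right_of_mem_closure {T : Type u} [Mul T] [TopologicalSpace T]
    (hT : IsSemitopologicalSemilattice T) {s : Set T} {t c : T} (ht : t ∈ closure s)
    (h : ∀ x ∈ s, c * x = c) : c * t = c := by
  have := hT.2.1
  exact closure_minimal (t := {x | c * x = c}) h (isClosed_eq (hT.2.2 c) continuous_const) ht

theorem mul_eq_left_or_right_of_mem_closure {T : Type u} [Mul T] [TopologicalSpace T]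
    (hT : IsSemitopologicalSemilattice T) {s : Set T} {t c : T} (ht : t ∈ closure s)
    (h : ∀ x ∈ s, c * x = c ∨ x * c = x) : c * t = c ∨ t * c = t := by
  have hs : s ⊆ {x ∈ s | c * x = c} ∪ {x ∈ s | x * c = x} := fun x hx =>
    (h x hx).imp (⟨hx, ·⟩) (⟨hx, ·⟩)
  rcases closure_union (X := T) ▸ closure_mono hs ht with ht | ht
  · exact .inl (mul_eq_right_of_mem_closure hT ht fun x hx => hx.2)
  · exact .inr (mul_eq_left_of_mem_closure hT ht fun x hx => hx.2)

/-- A linearly ordered semitopological semilattice is `H`-closed in the class of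
semitopological semilattices iff it is complete and conditions (ii), (iii) on
suprema of down-directed sets and infima of up-directed sets hold.
(Here `x ≤ y` iff `x * y = x`.) -/
theorem stmt11 {E : Type u} [Mul E] [TopologicalSpace E]
    (hE : IsSemitopologicalSemilattice E)
    (hlin : ∀ x y : E, x * y = x ∨ x * y = y) :
    HClosedInSemitopSemilattices E ↔
      ((∀ A : Set E, A.Nonempty →
          (∃ s, (∀ a ∈ A, s * a = s) ∧ ∀ b, (∀ a ∈ A, b * a = b) → b * s = b) ∧
            ∃ s, (∀ a ∈ A, a * s = a) ∧ ∀ b, (∀ a ∈ A, a * b = a) → s * b = s) ∧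
        (∀ (A : Set E) (x : E), A.Nonempty →
          A = {y | ∃ a ∈ A, y * a = y} \ {x} →
          ((∀ a ∈ A, a * x = a) ∧ ∀ b, (∀ a ∈ A, a * b = a) → x * b = x) →
          x ∈ closure A) ∧
        ∀ (B : Set E) (x : E), B.Nonempty →
          B = {y | ∃ b ∈ B, b * y = b} \ {x} →
          ((∀ b ∈ B, x * b = x) ∧ ∀ c, (∀ b ∈ B, c * b = c) → c * x = c) →
          x ∈ closure B) := by
  have hmap : ∀ x y : E, x * y = x ∨ y * x = y := fun x y =>
    (hlin x y).imp_right fun h => by rw [hE.1.2.1, h]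
  constructor
  · intro h
    let : LinearOrder E := hE.1.linearOrder hlin
    have hle (x y : E) : x ≤ y ↔ x * y = x := Iff.rfl
    have := hE.2.1
    have : T2Space Eᵒᵈ := inferInstanceAs (T2Space E)
    have : ClosedIicTopology E := ⟨fun a => by
      simp only [Set.Iic, hle, hE.1.2.1 _ a]
      exact isClosed_eq (hE.2.2 a) continuous_id⟩
    have : ClosedIciTopology E := ⟨fun a => isClosed_eq (hE.2.2 a) continuous_const⟩
    have hord : IsOrderHClosed E := h.isOrderHClosed fun x y => by
      rcases le_total x y with hxy | hxy
      · rw [min_eq_left hxy, (hle _ _).1 hxy]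
      · rw [min_eq_right hxy, hE.1.2.1, (hle _ _).1 hxy]
    refine ⟨fun A hA => ⟨?_, ?_⟩, fun A x hne hA hx => ?_, fun B x hne hB hx => ?_⟩
    · obtain ⟨s, hs, hs'⟩ := hord.dual.exists_isLUB (A := OrderDual.ofDual ⁻¹' A) hA
      exact ⟨OrderDual.ofDual s, fun a ha => hs (a := OrderDual.toDual a) ha,
        fun b hb => hs' (a := OrderDual.toDual b) fun a ha => hb a ha⟩
    · obtain ⟨s, hs, hs'⟩ := hord.exists_isLUB hA
      exact ⟨s, fun a ha => hs ha, fun b hb => hs' fun a ha => hb a ha⟩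
    · exact hord.mem_closure_of_isLUB hne hA ⟨fun a ha => hx.1 a ha,
        fun b hb => hx.2 b fun a ha => hb ha⟩
    · exact hord.dual.mem_closure_of_isLUB (A := OrderDual.ofDual ⁻¹' B)
        (x := OrderDual.toDual x) hne hB
        ⟨fun a ha => hx.1 a ha, fun b hb => hx.2 b fun a ha => hb (a := OrderDual.toDual a) ha⟩
  · rintro ⟨hcomplete, hsup, hinf⟩ T _ _ hT f hf hemb
    refine isClosed_of_closure_subset fun t ht => ?_
    by_contra htf
    have hle {x y : E} (hxy : x * y = x) : f x * f y = f x := by rw [← hf, hxy]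
    have hcomp (e : E) : f e * t = f e ∨ t * f e = t :=
      mul_eq_left_or_right_of_mem_closure hT ht <| by
        rintro _ ⟨y, rfl⟩
        exact (hmap e y).imp hle hle
    have hdisj (e : E) (h₁ : f e * t = f e) (h₂ : t * f e = t) : False :=
      htf ⟨e, by rw [← h₁, hT.1.2.1, h₂]⟩
    have htrans {x y z : T} (hxy : x * y = x) (hyz : y * z = y) : x * z = x := by
      rw [← hxy, hT.1.1, hyz]
    have hmem {A : Set E} {x : E} (hx : x ∈ closure A) : f x ∈ closure (f '' A) :=
      image_closure_subset_closure_image hemb.continuous ⟨x, hx, rfl⟩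
    have hrange : Set.range f ⊆ f '' {e | f e * t = f e} ∪ f '' {e | t * f e = t} := by
      rintro _ ⟨e, rfl⟩
      exact (hcomp e).imp (fun h => ⟨e, h, rfl⟩) fun h => ⟨e, h, rfl⟩
    rcases closure_union (X := T) ▸ closure_mono hrange ht with ht' | ht'
    · have hne : {e | f e * t = f e}.Nonempty :=
        Set.image_nonempty.1 (closure_nonempty_iff.1 ⟨t, ht'⟩)
      obtain ⟨x, hx⟩ := (hcomplete _ hne).2
      have htx : t * f x = t := mul_eq_left_of_mem_closure hT ht' <| by
        rintro _ ⟨a, ha, rfl⟩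
        exact hle (hx.1 a ha)
      refine hdisj x (mul_eq_left_of_mem_closure hT (hmem (hsup _ x hne ?_ hx)) ?_) htx
      · ext y
        refine ⟨fun hy => ⟨⟨y, hy, hE.1.2.2 y⟩, ?_⟩, fun ⟨⟨a, ha, hya⟩, _⟩ => htrans (hle hya) ha⟩
        rintro rfl
        exact hdisj y hy htx
      · rintro _ ⟨a, ha, rfl⟩
        exact ha
    · have hne : {e | t * f e = t}.Nonempty :=
        Set.image_nonempty.1 (closure_nonempty_iff.1 ⟨t, ht'⟩)
      obtain ⟨x, hx⟩ := (hcomplete _ hne).1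
      have hxt : f x * t = f x := mul_eq_right_of_mem_closure hT ht' <| by
        rintro _ ⟨a, ha, rfl⟩
        exact hle (hx.1 a ha)
      refine hdisj x hxt (mul_eq_right_of_mem_closure hT (hmem (hinf _ x hne ?_ hx)) ?_)
      · ext y
        refine ⟨fun hy => ⟨⟨y, hy, hE.1.2.2 y⟩, ?_⟩, fun ⟨⟨a, ha, hay⟩, _⟩ => htrans ha (hle hay)⟩
        rintro rfl
        exact hdisj y hxt hy
      · rintro _ ⟨a, ha, rfl⟩
        exact ha
end

section
/- Every linearly ordered semitopological semilattice that is H-closed in the class of semitopological semilattices is absolutely H-closed in the class of semitopological semilattices: if E is a linearly ordered semitopological semilattice such that the image of E under every topological embedding into a semitopological semilattice that is a homomorphism is closed, then for every semitopological semilattice T and every continuous semigroup homomorphism h : E → T the image h(E) is closed in T. -/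
open Topology

universe u v

open Classical in
/-- The multiplication on `Option E` which places `none` right above `L` and below the rest
of `E`. -/
noncomputable abbrev gapMul {E : Type u} [Mul E] (L : Set E) : Mul (Option E) where
  mul
    | some x, some y => some (x * y)
    | some x, none => if x ∈ L then some x else none
    | none, some y => if y ∈ L then some y else none
    | none, none => none

/-- The topology on `Option E` in which `E` is open and the neighbourhoods of `none` are
the preimages under `h` of the neighbourhoods of `t`, together with `none`. -/
abbrev adjoinTopology {E : Type u} {T : Type v} [TopologicalSpace E] [TopologicalSpace T]
    (h : E → T) (t : T) : TopologicalSpace (Option E) where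
  IsOpen O := IsOpen (some ⁻¹' O) ∧ (none ∈ O → ∃ V, IsOpen V ∧ t ∈ V ∧ h ⁻¹' V ⊆ some ⁻¹' O)
  isOpen_univ := ⟨isOpen_univ, fun _ => ⟨Set.univ, isOpen_univ, trivial, fun _ _ => trivial⟩⟩
  isOpen_inter := by
    rintro A B ⟨hA, hA'⟩ ⟨hB, hB'⟩
    refine ⟨hA.inter hB, fun hn => ?_⟩
    obtain ⟨V, hV, htV, hVA⟩ := hA' hn.1
    obtain ⟨W, hW, htW, hWB⟩ := hB' hn.2
    exact ⟨V ∩ W, hV.inter hW, ⟨htV, htW⟩, fun x hx => ⟨hVA hx.1, hWB hx.2⟩⟩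
  isOpen_sUnion := by
    intro S hS
    refine ⟨?_, ?_⟩
    · rw [Set.preimage_sUnion]
      exact isOpen_biUnion fun A hA => (hS A hA).1
    · rintro ⟨A, hA, hn⟩
      obtain ⟨V, hV, htV, hVA⟩ := (hS A hA).2 hn
      exact ⟨V, hV, htV, fun x hx => ⟨A, hA, hVA hx⟩⟩

theorem isOpenEmbedding_some_adjoinTopology {E : Type u} {T : Type v} [TopologicalSpace E]
    [TopologicalSpace T] (h : E → T) (t : T) :
    @IsOpenEmbedding E (Option E) _ (adjoinTopology h t) some := by
  let := adjoinTopology h t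
  refine .of_continuous_injective_isOpenMap ⟨fun O hO => hO.1⟩
    (Option.some_injective E) fun O hO => ⟨?_, ?_⟩
  · rwa [Set.preimage_image_eq _ (Option.some_injective E)]
  · rintro ⟨x, -, hx⟩
    cases hx

theorem t2Space_adjoinTopology {E : Type u} {T : Type v} [TopologicalSpace E] [T2Space E]
    [TopologicalSpace T] [T2Space T] {h : E → T} {t : T} (hc : Continuous h)
    (ht : t ∉ Set.range h) : @T2Space (Option E) (adjoinTopology h t) := by
  let := adjoinTopology h t
  have key : ∀ x : E, ∃ A B : Set (Option E), IsOpen A ∧ IsOpen B ∧ some x ∈ A ∧ none ∈ B ∧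
      Disjoint A B := by
    intro x
    obtain ⟨V, W, hV, hW, hxV, htW, hd⟩ := t2_separation (fun e : h x = t => ht ⟨x, e⟩)
    refine ⟨some '' (h ⁻¹' V), insert none (some '' (h ⁻¹' W)),
      (isOpenEmbedding_some_adjoinTopology h t).isOpenMap _ (hV.preimage hc), ⟨?_, ?_⟩,
      ⟨x, hxV, rfl⟩, Or.inl rfl, ?_⟩
    · have : some ⁻¹' insert none (some '' (h ⁻¹' W)) = h ⁻¹' W := by ext; simp
      rw [this]
      exact hW.preimage hc
    · exact fun _ => ⟨W, hW, htW, fun y hy => Or.inr ⟨y, hy, rfl⟩⟩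
    · rw [Set.disjoint_left]
      rintro _ ⟨y, hy, rfl⟩ (h' | ⟨z, hz, h'⟩)
      · cases h'
      · cases h'
        exact Set.disjoint_left.1 hd hy hz
  refine ⟨?_⟩
  rintro (_ | x) (_ | y) hxy
  · exact absurd rfl hxy
  · obtain ⟨A, B, hA, hB, h₁, h₂, hd⟩ := key y
    exact ⟨B, A, hB, hA, h₂, h₁, hd.symm⟩
  · exact key x
  · obtain ⟨V, W, hV, hW, hxV, hyW, hd⟩ := t2_separation (fun e : x = y => hxy (e ▸ rfl))
    have hmap := (isOpenEmbedding_some_adjoinTopology h t).isOpenMap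
    exact ⟨_, _, hmap V hV, hmap W hW, ⟨x, hxV, rfl⟩, ⟨y, hyW, rfl⟩,
      (Set.disjoint_image_iff (Option.some_injective E)).2 hd⟩

theorem isSemilatticeMul_gapMul {E : Type u} [Mul E] (hE : IsSemilatticeMul E) {L : Set E}
    (hmem : ∀ x y, x * y ∈ L ↔ x ∈ L ∨ y ∈ L)
    (hmul : ∀ x y, x ∈ L → y ∉ L → x * y = x) : @IsSemilatticeMul (Option E) (gapMul L) := by
  let := gapMul L
  obtain ⟨hassoc, hcomm, hidem⟩ := hE
  have hmul' : ∀ x y, x ∈ L → y ∉ L → y * x = x := fun x y hx hy => by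
    rw [hcomm, hmul x y hx hy]
  have hss : ∀ x y : E, (some x * some y : Option E) = some (x * y) := fun _ _ => rfl
  have hsn : ∀ x ∈ L, (some x * none : Option E) = some x := fun _ hx => if_pos hx
  have hsn' : ∀ x ∉ L, (some x * none : Option E) = none := fun _ hx => if_neg hx
  have hns : ∀ x ∈ L, (none * some x : Option E) = some x := fun _ hx => if_pos hx
  have hns' : ∀ x ∉ L, (none * some x : Option E) = none := fun _ hx => if_neg hx
  have hnn : (none * none : Option E) = none := rfl
  refine ⟨?_, ?_, ?_⟩
  · rintro (_ | x) (_ | y) (_ | z)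
    · rfl
    · by_cases hz : z ∈ L <;> simp [*]
    · by_cases hy : y ∈ L <;> simp [*]
    · by_cases hy : y ∈ L <;> by_cases hz : z ∈ L <;> simp [*]
    · by_cases hx : x ∈ L <;> simp [*]
    · by_cases hx : x ∈ L <;> by_cases hz : z ∈ L <;> simp [*]
    · by_cases hx : x ∈ L <;> by_cases hy : y ∈ L <;> simp [*]
    · simp [hss, hassoc]
  · rintro (_ | x) (_ | y)
    · rfl
    · by_cases hy : y ∈ L <;> simp [*]
    · by_cases hx : x ∈ L <;> simp [*]
    · simp only [hss, hcomm]
  · rintro (_ | x)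
    · rfl
    · simp only [hss, hidem]

/-- Every linearly ordered semitopological semilattice which is `H`-closed in the
class of semitopological semilattices is absolutely `H`-closed in that class. -/
theorem stmt12 {E : Type u} [Mul E] [TopologicalSpace E]
    (hE : IsSemitopologicalSemilattice E)
    (hlin : ∀ x y : E, x * y = x ∨ x * y = y)
    (hH : HClosedInSemitopSemilattices E) :
    ∀ (T : Type u) [Mul T] [TopologicalSpace T], IsSemitopologicalSemilattice T →
      ∀ h : E → T, Continuous h → (∀ x y : E, h (x * y) = h x * h y) →
        IsClosed (Set.range h) := by
  intro T _ _ hT h hc hh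
  by_contra hncl
  obtain ⟨t, htc, ht⟩ : ∃ t ∈ closure (Set.range h), t ∉ Set.range h := by
    by_contra! hcl
    exact hncl (isClosed_of_closure_subset hcl)
  obtain ⟨⟨-, hTcomm, -⟩, hT2, hTc⟩ := id hT
  have hTassoc := hT.1.1
  obtain ⟨-, hE2, hEc⟩ := id hE
  have hcomp : ∀ a, h a * t = h a ∨ h a * t = t := by
    intro a
    have hclosed : IsClosed {s | h a * s = h a ∨ h a * s = s} :=
      (isClosed_eq (hTc _) continuous_const).union (isClosed_eq (hTc _) continuous_id)
    refine closure_minimal ?_ hclosed htc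
    rintro _ ⟨y, rfl⟩
    exact (hlin a y).imp (fun e => by rw [← hh, e]) (fun e => by rw [← hh, e])
  let L : Set E := {x | h x * t = h x}
  have hL : ∀ x, x ∉ L → h x * t = t := fun x hx => (hcomp x).resolve_left hx
  have hLclosed : IsClosed L := by
    refine isClosed_eq ?_ hc
    simp only [hTcomm _ t]
    exact (hTc t).comp hc
  have hLopen : IsOpen L := by
    have hLc : Lᶜ = {x | t * h x = t} := by
      ext x
      refine ⟨fun hx => (hTcomm _ _).trans (hL x hx), fun hx hx' => ht ⟨x, ?_⟩⟩
      exact hx'.symm.trans ((hTcomm _ _).trans hx)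
    rw [← isClosed_compl_iff, hLc]
    exact isClosed_eq ((hTc t).comp hc) continuous_const
  have hmem : ∀ x y, x * y ∈ L ↔ x ∈ L ∨ y ∈ L := by
    intro x y
    constructor
    · intro hxy
      rcases hlin x y with e | e <;> rw [e] at hxy
      exacts [Or.inl hxy, Or.inr hxy]
    · rintro (hx | hx)
      · change h (x * y) * t = h (x * y)
        rw [hh, hTcomm (h x), hTassoc, hx]
      · change h (x * y) * t = h (x * y)
        rw [hh, hTassoc, hx]
  have hmul : ∀ x y, x ∈ L → y ∉ L → x * y = x := fun x y hx hy =>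
    (hlin x y).resolve_right fun e => hy (e ▸ (hmem x y).2 (Or.inl hx))
  let := gapMul L
  let := adjoinTopology h t
  have hsn : ∀ x ∈ L, (some x * none : Option E) = some x := fun _ hx => if_pos hx
  have hsn' : ∀ x ∉ L, (some x * none : Option E) = none := fun _ hx => if_neg hx
  have hns : ∀ x ∈ L, (none * some x : Option E) = some x := fun _ hx => if_pos hx
  have hns' : ∀ x ∉ L, (none * some x : Option E) = none := fun _ hx => if_neg hx
  have hcont : ∀ a : Option E, Continuous fun x => a * x := by
    rintro (_ | a) <;> refine ⟨fun O hO => ⟨?_, fun hn => ?_⟩⟩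
    · by_cases hn : none ∈ O
      · have : some ⁻¹' ((fun x => none * x) ⁻¹' O) = some ⁻¹' O ∪ Lᶜ := by
          ext x
          by_cases hx : x ∈ L <;> simp [*]
        rw [this]
        exact hO.1.union hLclosed.isOpen_compl
      · have : some ⁻¹' ((fun x => none * x) ⁻¹' O) = some ⁻¹' O ∩ L := by
          ext x
          by_cases hx : x ∈ L <;> simp [*]
        rw [this]
        exact hO.1.inter hLopen
    · have hn' : none ∈ O := hn
      obtain ⟨V, hV, htV, hVO⟩ := hO.2 hn'
      refine ⟨V, hV, htV, fun x hx => ?_⟩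
      have hxO : some x ∈ O := hVO hx
      by_cases hx : x ∈ L <;> simp [*]
    · exact hO.1.preimage (hEc a)
    · by_cases ha : a ∈ L
      · have haO : some a ∈ O := by simpa [hsn a ha] using hn
        refine ⟨{s | h a * s = s}ᶜ, (isClosed_eq (hTc _) continuous_id).isOpen_compl,
          fun e => ht ⟨a, ha.symm.trans e⟩, fun x hx => ?_⟩
        have hax : a * x = a := (hlin a x).resolve_right fun e => hx (by
          change h a * h x = h x
          rw [← hh, e])
        change some (a * x) ∈ O
        rwa [hax]
      · have hnO : none ∈ O := by simpa [hsn' a ha] using hn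
        obtain ⟨V, hV, htV, hVO⟩ := hO.2 hnO
        refine ⟨_, hV.preimage (hTc (h a)), ?_, fun x hx => hVO ?_⟩
        · change h a * t ∈ V
          rwa [hL a ha]
        · change h (a * x) ∈ V
          rw [hh]
          exact hx
  have hclosed := hH (Option E) ⟨isSemilatticeMul_gapMul hE.1 hmem hmul,
    t2Space_adjoinTopology hc ht, hcont⟩ some (fun _ _ => rfl)
    (isOpenEmbedding_some_adjoinTopology h t).isEmbedding
  obtain ⟨V, hV, htV, hVs⟩ := hclosed.isOpen_compl.2 (by simp)
  obtain ⟨_, hxV, x, rfl⟩ := mem_closure_iff.1 htc V hV htV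
  exact hVs hxV ⟨x, rfl⟩
end

section
/- Let 𝓕 be a free filter on ℕ (i.e. ⋂𝓕 = ∅) and let F ∈ 𝓕 be a set whose complement ℕ \ F is infinite. Let ℕ_{𝓕,min} be the topological semilattice on ℕ ∪ {𝓕} where every n ∈ ℕ is isolated, the sets A ∪ {𝓕} for A ∈ 𝓕 form a neighbourhood base at the point 𝓕, and the operation is min on ℕ extended by min(n,𝓕) = min(𝓕,n) = n and min(𝓕,𝓕) = 𝓕. Let E₂ = {0,1} be the discrete semilattice with operation min. Then the subsemilattice E = (ℕ_{𝓕,min} × {0}) ∪ ((ℕ \ F) × {1}) of the product semilattice ℕ_{𝓕,min} × E₂, with the subspace topology, is H-closed in the class of semitopological semilattices but is not absolutely H-closed in the class of semitopological semilattices. -/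
open Topology

universe u v

/-- `E` is absolutely `H`-closed in the class of semitopological semilattices. -/
def AbsHClosedInSemitopSemilattices (E : Type u) [Mul E] [TopologicalSpace E] : Prop :=
  ∀ (T : Type u) [Mul T] [TopologicalSpace T], IsSemitopologicalSemilattice T →
    ∀ f : E → T, Continuous f → (∀ x y : E, f (x * y) = f x * f y) →
      IsClosed (Set.range f)

/-- The topology of the space `ℕ_𝓕 = ℕ ∪ {𝓕}` (modelled on `WithTop ℕ`, the point
`𝓕` being `⊤`): all points of `ℕ` are isolated and the sets `A ∪ {⊤}`, `A ∈ 𝓕`,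
form a neighbourhood base at `⊤`. -/
def filterTopology (F : Filter ℕ) : TopologicalSpace (WithTop ℕ) where
  IsOpen U := ⊤ ∈ U → {n : ℕ | (n : WithTop ℕ) ∈ U} ∈ F
  isOpen_univ := fun _ => by simp
  isOpen_inter := fun U V hU hV h => Filter.inter_mem (hU h.1) (hV h.2)
  isOpen_sUnion := by
    intro S hS h
    rcases h with ⟨U, hUS, hU⟩
    exact Filter.mem_of_superset (hS U hUS hU) fun n hn => ⟨U, hUS, hn⟩

/-- The carrier of the product `ℕ_{𝓕,min} × E₂`, where `E₂ = {0,1}` is modelled on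
`Bool` (`0 = false`, `1 = true`). -/
structure NFPt : Type where
  a : WithTop ℕ
  b : Bool

/-- The product semilattice operation: componentwise minimum. -/
instance : Mul NFPt := ⟨fun p q => ⟨min p.a q.a, p.b && q.b⟩⟩

/-- The product topology on `ℕ_{𝓕,min} × E₂`, the factor `E₂` being discrete. -/
def nfTop (F : Filter ℕ) : TopologicalSpace NFPt :=
  TopologicalSpace.induced (fun p : NFPt => p.a) (filterTopology F) ⊓
    TopologicalSpace.induced (fun p : NFPt => p.b) ⊥

/-- The subsemilattice `E = (ℕ_{𝓕,min} × {0}) ∪ ((ℕ \ F) × {1})`. -/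
abbrev ESub (Fs : Set ℕ) : Type :=
  {p : NFPt // p.b = true → ∃ n : ℕ, n ∉ Fs ∧ p.a = (n : WithTop ℕ)}

instance (Fs : Set ℕ) : Mul (ESub Fs) :=
  ⟨fun p q => ⟨p.1 * q.1, by
    intro hb
    have hpq : p.1.b = true ∧ q.1.b = true := by
      have h : (p.1.b && q.1.b) = true := hb
      simpa [Bool.and_eq_true] using h
    obtain ⟨m, hm, ham⟩ := p.2 hpq.1
    obtain ⟨n, hn, han⟩ := q.2 hpq.2
    rcases le_total m n with hmn | hmn
    · refine ⟨m, hm, ?_⟩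
      show min p.1.a q.1.a = (m : WithTop ℕ)
      rw [ham, han]
      exact min_eq_left (WithTop.coe_le_coe.mpr hmn)
    · refine ⟨n, hn, ?_⟩
      show min p.1.a q.1.a = (n : WithTop ℕ)
      rw [ham, han]
      exact min_eq_right (WithTop.coe_le_coe.mpr hmn)⟩⟩

theorem le_cofinite_of_sInter_sets_eq_empty {α : Type*} {F : Filter α} (h : ⋂₀ F.sets = ∅) :
    F ≤ Filter.cofinite := by
  rw [Filter.le_cofinite_iff_compl_singleton_mem]
  intro x
  have hx : x ∉ ⋂₀ F.sets := by simp [h]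
  simp only [Set.mem_sInter, not_forall] at hx
  obtain ⟨s, hs, hxs⟩ := hx
  exact Filter.mem_of_superset hs fun y hy hyx => hxs (hyx ▸ hy)

theorem tendsto_coe_filterTopology (F : Filter ℕ) :
    Filter.Tendsto (fun n : ℕ => (n : WithTop ℕ)) F (@nhds _ (filterTopology F) ⊤) := by
  let _ := filterTopology F
  rw [tendsto_nhds]
  exact fun U hU hT => hU hT

theorem filterTopology_mono {F G : Filter ℕ} (h : F ≤ G) :
    filterTopology F ≤ filterTopology G :=
  fun _ hU hT => h (hU hT)

theorem t2Space_filterTopology {F : Filter ℕ} (h : F ≤ Filter.cofinite) :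
    @T2Space (WithTop ℕ) (filterTopology F) := by
  let _ := filterTopology F
  have isOpen_coe (n : ℕ) : IsOpen {(n : WithTop ℕ)} := fun hT =>
    absurd hT (WithTop.coe_ne_top (a := n)).symm
  have isOpen_compl (n : ℕ) : IsOpen {(n : WithTop ℕ)}ᶜ := fun _ => by
    refine Filter.mem_of_superset
      (Filter.le_cofinite_iff_compl_singleton_mem.1 h n) fun m hm hmn => hm ?_
    exact WithTop.coe_injective hmn
  refine ⟨fun x y hxy => ?_⟩
  induction x using WithTop.recTopCoe with
  | coe n => exact ⟨_, _, isOpen_coe n, isOpen_compl n, rfl, hxy.symm, disjoint_compl_right⟩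
  | top =>
    induction y using WithTop.recTopCoe with
    | top => exact absurd rfl hxy
    | coe n => exact ⟨_, _, isOpen_compl n, isOpen_coe n, hxy, rfl, disjoint_compl_left⟩

theorem continuous_min_filterTopology {F : Filter ℕ} (h : F ≤ Filter.cofinite) (c : WithTop ℕ) :
    @Continuous _ _ (filterTopology F) (filterTopology F) fun x : WithTop ℕ => min c x := by
  let _ := filterTopology F
  induction c using WithTop.recTopCoe with
  | top =>
    simp only [min_eq_right le_top]
    exact continuous_id
  | coe n =>
    refine continuous_def.2 fun U _ hT => ?_
    have hn : (n : WithTop ℕ) ∈ U := by simpa using hT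
    refine h (Filter.mem_of_superset (Nat.cofinite_eq_atTop ▸ Filter.eventually_ge_atTop n)
      fun m hm => ?_)
    have hnm : min (n : WithTop ℕ) m = n := min_eq_left (WithTop.coe_le_coe.2 hm)
    change min (n : WithTop ℕ) m ∈ U
    rwa [hnm]

namespace NFPt

theorem mul_a (p q : NFPt) : (p * q).a = min p.a q.a := rfl

theorem mul_b (p q : NFPt) : (p * q).b = (p.b && q.b) := rfl

theorem ext_ab {p q : NFPt} (ha : p.a = q.a) (hb : p.b = q.b) : p = q := by
  cases p; cases q; simp_all

theorem continuous_a (F : Filter ℕ) :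
    @Continuous _ _ (nfTop F) (filterTopology F) NFPt.a :=
  continuous_iff_le_induced.2 inf_le_left

theorem continuous_b (F : Filter ℕ) : @Continuous _ _ (nfTop F) ⊥ NFPt.b :=
  continuous_iff_le_induced.2 inf_le_right

theorem continuous_of_components {F : Filter ℕ} {X : Type*} [TopologicalSpace X] {f : X → NFPt}
    (ha : @Continuous _ _ _ (filterTopology F) fun x => (f x).a)
    (hb : @Continuous _ _ _ ⊥ fun x => (f x).b) : @Continuous _ _ _ (nfTop F) f :=
  continuous_inf_rng.2 ⟨continuous_induced_rng.2 ha, continuous_induced_rng.2 hb⟩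

theorem nfTop_mono {F G : Filter ℕ} (h : F ≤ G) : nfTop F ≤ nfTop G :=
  inf_le_inf_right _ (induced_mono (filterTopology_mono h))

theorem isSemilatticeMul : IsSemilatticeMul NFPt :=
  ⟨fun _ _ _ => ext_ab (min_assoc _ _ _) (Bool.and_assoc _ _ _),
    fun _ _ => ext_ab (min_comm _ _) (Bool.and_comm _ _),
    fun _ => ext_ab (min_self _) (Bool.and_self _)⟩

theorem isSemitopologicalSemilattice {F : Filter ℕ} (h : F ≤ Filter.cofinite) :
    @IsSemitopologicalSemilattice NFPt _ (nfTop F) := by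
  let _ := nfTop F
  let _ := filterTopology F
  let _ := t2Space_filterTopology h
  refine ⟨isSemilatticeMul, ?_, fun c => continuous_of_components ?_ ?_⟩
  · refine T2Space.of_injective_continuous (f := fun p : NFPt => (p.a, p.b))
      (fun p q hpq => ext_ab (congrArg Prod.fst hpq) (congrArg Prod.snd hpq)) ?_
    exact (continuous_a F).prodMk (continuous_b F)
  · exact (continuous_min_filterTopology h c.a).comp (continuous_a F)
  · exact (continuous_of_discreteTopology (f := fun b => c.b && b)).comp (continuous_b F)

end NFPt

namespace ESub

/-- The point `(a, 0)` of `E`. -/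
def bottom (Fs : Set ℕ) (a : WithTop ℕ) : ESub Fs := ⟨⟨a, false⟩, by simp⟩

theorem continuous_bottom (F : Filter ℕ) (Fs : Set ℕ) :
    letI := nfTop F
    @Continuous _ (ESub Fs) (filterTopology F) _ (bottom Fs) := by
  let _ := nfTop F
  let _ := filterTopology F
  exact continuous_induced_rng.2
    (NFPt.continuous_of_components continuous_id continuous_const)

theorem finite_setOf_a_lt (Fs : Set ℕ) (n : ℕ) :
    {x : ESub Fs | x.1.a < (n : WithTop ℕ)}.Finite := by
  have hinj : Function.Injective fun x : ESub Fs => (x.1.a, x.1.b) := fun x y h =>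
    Subtype.ext (NFPt.ext_ab (congrArg Prod.fst h) (congrArg Prod.snd h))
  have hfin : (Set.Iio (n : WithTop ℕ)).Finite := by
    refine ((Set.finite_Iio n).image ((↑) : ℕ → WithTop ℕ)).subset fun x hx => ?_
    obtain ⟨m, rfl, -⟩ := WithTop.lt_iff_exists_coe.1 hx
    exact ⟨m, WithTop.coe_lt_coe.1 hx, rfl⟩
  refine ((hfin.prod (Set.toFinite (Set.univ : Set Bool))).preimage hinj.injOn).subset ?_
  exact fun x hx => ⟨hx, trivial⟩

theorem hClosed (F : Filter ℕ) [F.NeBot] {Fs : Set ℕ} (hFs : Fs ∈ F) :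
    letI : TopologicalSpace NFPt := nfTop F
    HClosedInSemitopSemilattices (ESub Fs) := by
  let _ : TopologicalSpace NFPt := nfTop F
  intro T _ _ hT f hf hemb
  obtain ⟨⟨-, hcomm, -⟩, hT2, hcont⟩ := hT
  refine isClosed_of_closure_subset fun e he => ?_
  by_contra hne
  have hnb : (Filter.comap f (𝓝 e)).NeBot :=
    Filter.comap_neBot_iff_frequently.2 (mem_closure_iff_frequently.1 he)
  obtain ⟨u, hu⟩ := Ultrafilter.exists_le (Filter.comap f (𝓝 e))
  have hlim : Filter.Tendsto f u (𝓝 e) := Filter.tendsto_iff_comap.2 hu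
  have hge (n : ℕ) : ∀ᶠ x in (u : Filter (ESub Fs)), (n : WithTop ℕ) ≤ x.1.a := by
    by_contra hcon
    have hlt : {x : ESub Fs | x.1.a < (n : WithTop ℕ)} ∈ u := by
      filter_upwards [Ultrafilter.eventually_not.2 hcon] with x hx using not_le.1 hx
    obtain ⟨p, -, rfl⟩ := Ultrafilter.eq_pure_of_finite_mem (finite_setOf_a_lt Fs n) hlt
    have hp : Filter.Tendsto f (pure p) (𝓝 (f p)) := tendsto_pure_nhds f p
    exact hne ⟨p, tendsto_nhds_unique hp hlim⟩
  have hmul_coe (n : ℕ) : f (bottom Fs n) * e = f (bottom Fs n) := by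
    refine tendsto_nhds_unique (((hcont _).tendsto e).comp hlim)
      (tendsto_const_nhds.congr' ?_)
    filter_upwards [hge n] with x hx
    rw [Function.comp_apply, ← hf]
    exact congrArg f (Subtype.ext (NFPt.ext_ab (min_eq_left hx).symm rfl))
  have hbot : Filter.Tendsto (fun n : ℕ => f (bottom Fs n)) F (𝓝 (f (bottom Fs ⊤))) := by
    let _ := filterTopology F
    exact ((hemb.continuous.comp (continuous_bottom F Fs)).tendsto ⊤).comp
      (tendsto_coe_filterTopology F)
  have hmul_top : f (bottom Fs ⊤) * e = f (bottom Fs ⊤) := by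
    rw [hcomm]
    refine tendsto_nhds_unique (((hcont e).tendsto _).comp hbot) (hbot.congr fun n => ?_)
    rw [Function.comp_apply, hcomm, hmul_coe]
  have hlim_top : Filter.Tendsto (fun x => f (bottom Fs ⊤ * x)) u (𝓝 (f (bottom Fs ⊤))) := by
    have := ((hcont (f (bottom Fs ⊤))).tendsto e).comp hlim
    rw [hmul_top] at this
    exact this.congr fun x => (hf _ _).symm
  have a_mul (x : ESub Fs) : (bottom Fs ⊤ * x).1.a = x.1.a := min_eq_right le_top
  rcases Ultrafilter.em u (fun x : ESub Fs => x.1.b = true) with hb | hb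
  · have hx : Filter.Tendsto (fun x => bottom Fs ⊤ * x) u (𝓝 (bottom Fs ⊤)) :=
      hemb.tendsto_nhds_iff.2 hlim_top
    let _ := filterTopology F
    have hopen : IsOpen (insert ⊤ ((↑) '' Fs) : Set (WithTop ℕ)) := fun _ =>
      Filter.mem_of_superset hFs fun n hn => Or.inr ⟨n, hn, rfl⟩
    have ha := (((NFPt.continuous_a F).comp continuous_subtype_val).tendsto (bottom Fs ⊤)).comp hx
    obtain ⟨x, hxU, hxb⟩ :=
      ((ha.eventually (hopen.mem_nhds (Set.mem_insert _ _))).and hb).exists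
    obtain ⟨n, hn, hxn⟩ := x.2 hxb
    replace hxU : (bottom Fs ⊤ * x).1.a ∈ (insert ⊤ ((↑) '' Fs) : Set (WithTop ℕ)) := hxU
    rw [a_mul, hxn] at hxU
    rcases hxU with h | ⟨m, hm, hmn⟩
    · exact WithTop.coe_ne_top h
    · obtain rfl : m = n := WithTop.coe_injective hmn
      exact hn hm
  · refine hne ⟨bottom Fs ⊤, tendsto_nhds_unique hlim_top (hlim.congr' ?_)⟩
    filter_upwards [hb] with x hx
    refine congrArg f (Subtype.ext (NFPt.ext_ab (a_mul x).symm ?_))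
    exact Bool.eq_false_of_not_eq_true hx

theorem not_absHClosed {F : Filter ℕ} (hF : F ≤ Filter.cofinite) {Fs : Set ℕ}
    (hinf : (Fsᶜ : Set ℕ).Infinite) :
    letI : TopologicalSpace NFPt := nfTop F
    ¬ AbsHClosedInSemitopSemilattices (ESub Fs) := by
  let _ : TopologicalSpace NFPt := nfTop F
  intro habs
  have hval : @Continuous (ESub Fs) NFPt _ (nfTop Filter.cofinite) Subtype.val :=
    continuous_le_rng (NFPt.nfTop_mono hF) continuous_subtype_val
  have hclosed := @habs NFPt _ (nfTop Filter.cofinite)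
    (NFPt.isSemitopologicalSemilattice le_rfl) Subtype.val hval fun _ _ => rfl
  let _ : TopologicalSpace (WithTop ℕ) := filterTopology Filter.cofinite
  let _ : TopologicalSpace NFPt := nfTop Filter.cofinite
  have hlim : Filter.Tendsto (fun n : ℕ => (⟨n, true⟩ : NFPt)) Filter.cofinite (𝓝 ⟨⊤, true⟩) :=
    ((NFPt.continuous_of_components (f := fun a => (⟨a, true⟩ : NFPt)) continuous_id
      continuous_const).tendsto ⊤).comp (tendsto_coe_filterTopology _)
  have hfreq : ∃ᶠ n in Filter.cofinite, n ∈ Fsᶜ := Filter.frequently_cofinite_iff_infinite.2 hinf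
  have hmem : (⟨⊤, true⟩ : NFPt) ∈ Set.range (Subtype.val : ESub Fs → NFPt) :=
    hclosed.mem_of_frequently_of_tendsto
      (hfreq.mono fun n hn => ⟨⟨⟨n, true⟩, fun _ => ⟨n, hn, rfl⟩⟩, rfl⟩) hlim
  obtain ⟨p, hp⟩ := hmem
  obtain ⟨n, -, hn⟩ := p.2 (by rw [hp])
  rw [hp] at hn
  exact WithTop.coe_ne_top hn.symm

end ESub

/-- For a free filter `𝓕` on `ℕ` and `F ∈ 𝓕` with infinite complement, the closed
subsemilattice `E = (ℕ_{𝓕,min} × {0}) ∪ ((ℕ \ F) × {1})` of `ℕ_{𝓕,min} × E₂`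
is `H`-closed but not absolutely `H`-closed in the class of semitopological
semilattices. -/
theorem stmt15 (F : Filter ℕ) [F.NeBot] (hfree : ⋂₀ F.sets = ∅)
    (Fs : Set ℕ) (hFs : Fs ∈ F) (hinf : (Fsᶜ : Set ℕ).Infinite) :
    letI : TopologicalSpace NFPt := nfTop F
    HClosedInSemitopSemilattices (ESub Fs) ∧
      ¬ AbsHClosedInSemitopSemilattices (ESub Fs) := by
  exact ⟨ESub.hClosed F hFs,
    ESub.not_absHClosed (le_cofinite_of_sInter_sets_eq_empty hfree) hinf⟩
end

section
/- Let S be a Hausdorff semitopological inverse monoid with zero and continuous inversion. Then the following are equivalent: (i) S is absolutely H-closed in the class of semitopological inverse semigroups with continuous inversion; (ii) there exists a cardinal λ ≥ 2 such that every topological Brandt λ⁰-extension of S in this class is absolutely H-closed in this class; (iii) for every cardinal λ ≥ 2, every topological Brandt λ⁰-extension of S in this class is absolutely H-closed in this class. -/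
open Topology

universe u v

/-- `i` is the inversion map of an inverse semigroup: every `x` has `i x` as its
unique inverse element (`x * i x * x = x`, `i x * x * i x = i x`). -/
def IsInvOf {S : Type u} [Mul S] (i : S → S) : Prop :=
  ∀ x : S, (x * i x * x = x ∧ i x * x * i x = i x) ∧
    ∀ y : S, x * y * x = x → y * x * y = y → y = i x

/-- A (Hausdorff) semitopological semigroup: an associative multiplication on a
Hausdorff topological space which is separately continuous. -/
def IsSemitopologicalSemigroup (S : Type u) [Mul S] [TopologicalSpace S] : Prop :=
  (∀ x y z : S, x * y * z = x * (y * z)) ∧ T2Space S ∧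
    (∀ a : S, Continuous fun x : S => a * x) ∧ (∀ a : S, Continuous fun x : S => x * a)

/-- Membership in the class of semitopological inverse semigroups with continuous
inversion, the inversion map being `i`. -/
def IsSTISWCI {S : Type u} [Mul S] [TopologicalSpace S] (i : S → S) : Prop :=
  IsSemitopologicalSemigroup S ∧ IsInvOf i ∧ Continuous i

/-- `S` is absolutely `H`-closed in the class of semitopological inverse semigroups
with continuous inversion: every continuous homomorphic image of `S` in a member of
the class is closed. -/
def AbsHClosedSTIS (S : Type u) [Mul S] [TopologicalSpace S] : Prop :=
  ∀ (T : Type u) [Mul T] [TopologicalSpace T] (iT : T → T), IsSTISWCI iT →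
    ∀ h : S → T, Continuous h → (∀ x y : S, h (x * y) = h x * h y) →
      IsClosed (Set.range h)

/-- `S` is `H`-closed in the class of semitopological inverse semigroups with
continuous inversion: the image of `S` under any homomorphic topological embedding
into a member of the class is closed. -/
def HClosedSTIS (S : Type u) [Mul S] [TopologicalSpace S] : Prop :=
  ∀ (T : Type u) [Mul T] [TopologicalSpace T] (iT : T → T), IsSTISWCI iT →
    ∀ h : S → T, (∀ x y : S, h (x * y) = h x * h y) → IsEmbedding h →
      IsClosed (Set.range h)

/-- The carrier of the Brandt `λ⁰`-extension `B⁰_λ(S)` of a monoid `S` with zero: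
the elements `(α, s, β)` with `s ∈ S \ {0}` together with a zero element. -/
inductive BrandtCarrier (lam : Type u) (S : Type u) [MonoidWithZero S] : Type u
  | zero : BrandtCarrier lam S
  | elt : lam → {s : S // s ≠ 0} → lam → BrandtCarrier lam S

/-- Multiplication of the Brandt `λ⁰`-extension:
`(α,a,β)·(γ,b,δ) = (α, a*b, δ)` if `β = γ` and `a*b ≠ 0`, and `0` otherwise. -/
noncomputable instance {lam S : Type u} [MonoidWithZero S] :
    Mul (BrandtCarrier lam S) :=
  ⟨fun x y =>
    match x, y with
    | .elt a s b, .elt c t d =>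
        letI := Classical.propDecidable (b = c ∧ (s : S) * (t : S) ≠ 0)
        if h : b = c ∧ (s : S) * (t : S) ≠ 0 then .elt a ⟨(s : S) * (t : S), h.2⟩ d
        else .zero
    | _, _ => .zero⟩

/-- The natural inclusion `S → B⁰_λ(S)`, `s ↦ (α, s, α)` for `s ≠ 0`, `0 ↦ 0`. -/
noncomputable def brandtEmb {lam S : Type u} [MonoidWithZero S] (a : lam) (s : S) :
    BrandtCarrier lam S :=
  letI := Classical.propDecidable (s = 0)
  if h : s = 0 then .zero else .elt a ⟨s, h⟩ a

/-- `tB` is a topological Brandt `λ⁰`-extension of `S` in the class of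
semitopological inverse semigroups with continuous inversion, with inversion `iB`:
the extension belongs to the class and for some `α ∈ λ` the subspace `S_{α,α}` is
naturally homeomorphic to `S`. -/
def IsTopBrandtExt {lam S : Type u} [MonoidWithZero S] [TopologicalSpace S]
    (tB : TopologicalSpace (BrandtCarrier lam S))
    (iB : BrandtCarrier lam S → BrandtCarrier lam S) : Prop :=
  letI := tB
  IsSTISWCI iB ∧ ∃ a : lam, IsEmbedding (brandtEmb (lam := lam) (S := S) a)

namespace BrandtCarrier

variable {lam S : Type u} [MonoidWithZero S]

/-- The element `(α, s, β)` of the Brandt extension, read as `0` when `s = 0`. -/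
noncomputable def entry (α : lam) (s : S) (β : lam) : BrandtCarrier lam S :=
  letI := Classical.propDecidable (s = 0)
  if h : s = 0 then .zero else .elt α ⟨s, h⟩ β

theorem brandtEmb_eq_entry (α : lam) (s : S) : brandtEmb α s = entry α s α := rfl

@[simp]
theorem entry_zero (α β : lam) : entry α (0 : S) β = zero := by simp [entry]

theorem entry_of_ne (α β : lam) {s : S} (hs : s ≠ 0) : entry α s β = elt α ⟨s, hs⟩ β := by
  simp [entry, hs]

theorem entry_eq_zero {α β : lam} {s : S} : entry α s β = zero ↔ s = 0 := by
  by_cases hs : s = 0 <;> simp [entry, hs]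

theorem entry_inj {α β γ δ : lam} {s t : S} (hs : s ≠ 0) (h : entry α s β = entry γ t δ) :
    α = γ ∧ s = t ∧ β = δ := by
  have ht : t ≠ 0 := by
    rintro rfl
    exact hs (entry_eq_zero.1 (h.trans (entry_zero γ δ)))
  simpa [entry_of_ne _ _ hs, entry_of_ne _ _ ht] using h

theorem eq_zero_or_entry (x : BrandtCarrier lam S) :
    x = zero ∨ ∃ α s β, s ≠ 0 ∧ x = entry α s β := by
  rcases x with _ | ⟨α, s, β⟩
  · exact .inl rfl
  · exact .inr ⟨α, s, β, s.2, (entry_of_ne _ _ s.2).symm⟩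

@[simp]
theorem zero_mul' (x : BrandtCarrier lam S) : zero * x = zero := rfl

@[simp]
theorem mul_zero' (x : BrandtCarrier lam S) : x * zero = zero := by
  cases x <;> rfl

@[simp]
theorem entry_mul_entry_same (α β δ : lam) (s t : S) :
    entry α s β * entry β t δ = entry α (s * t) δ := by
  by_cases hs : s = 0
  · simp [hs]
  by_cases ht : t = 0
  · simp [ht]
  rw [entry_of_ne _ _ hs, entry_of_ne _ _ ht]
  by_cases hst : s * t = 0
  · rw [hst, entry_zero]
    exact dif_neg (fun h : β = β ∧ s * t ≠ 0 => h.2 hst)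
  · rw [entry_of_ne _ _ hst]
    exact dif_pos (⟨rfl, hst⟩ : β = β ∧ s * t ≠ 0)

theorem entry_mul_entry_of_ne {β γ : lam} (hβγ : β ≠ γ) (α δ : lam) (s t : S) :
    entry α s β * entry γ t δ = zero := by
  by_cases hs : s = 0
  · simp [hs]
  by_cases ht : t = 0
  · simp [ht]
  rw [entry_of_ne _ _ hs, entry_of_ne _ _ ht]
  exact dif_neg (fun h : β = γ ∧ s * t ≠ 0 => hβγ h.1)

theorem mul_assoc' (x y z : BrandtCarrier lam S) : x * y * z = x * (y * z) := by
  obtain rfl | ⟨α, s, β, -, rfl⟩ := eq_zero_or_entry x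
  · simp
  obtain rfl | ⟨γ, t, δ, -, rfl⟩ := eq_zero_or_entry y
  · simp
  obtain rfl | ⟨μ, r, ν, -, rfl⟩ := eq_zero_or_entry z
  · simp
  by_cases h₁ : β = γ <;> by_cases h₂ : δ = μ
  · subst h₁ h₂; simp [mul_assoc]
  · subst h₁; simp [entry_mul_entry_of_ne h₂]
  · subst h₂; simp [entry_mul_entry_of_ne h₁]
  · simp [entry_mul_entry_of_ne h₁, entry_mul_entry_of_ne h₂]

/-- The inversion `(α, s, β) ↦ (β, s⁻¹, α)`. -/
noncomputable def inversion (i : S → S) : BrandtCarrier lam S → BrandtCarrier lam S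
  | .zero => .zero
  | .elt α s β => entry β (i s) α

theorem inversion_entry {i : S → S} (hi : IsInvOf i) (α β : lam) (s : S) :
    inversion i (entry α s β) = entry β (i s) α := by
  by_cases hs : s = 0
  · have h0 : i 0 = 0 := by simpa using ((hi 0).1.2).symm
    simp [hs, h0, inversion]
  · simp [entry_of_ne α β hs, inversion]

theorem isInvOf_inversion {i : S → S} (hi : IsInvOf i) :
    IsInvOf (inversion i : BrandtCarrier lam S → BrandtCarrier lam S) := by
  intro x
  obtain rfl | ⟨α, s, β, hs, rfl⟩ := eq_zero_or_entry x
  · refine ⟨by simp [inversion], fun y _ h => ?_⟩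
    simpa [inversion] using h.symm
  · rw [inversion_entry hi]
    refine ⟨by simp [(hi s).1], fun y hxyx hyxy => ?_⟩
    have hx : entry α s β ≠ zero := fun h => hs (entry_eq_zero.1 h)
    obtain rfl | ⟨γ, t, δ, ht, rfl⟩ := eq_zero_or_entry y
    · exact absurd (by simpa using hxyx.symm) hx
    obtain rfl : β = γ := by
      by_contra h
      exact hx (by simpa [entry_mul_entry_of_ne h] using hxyx.symm)
    obtain rfl : δ = α := by
      by_contra h
      exact hx (by simpa [entry_mul_entry_of_ne h] using hxyx.symm)
    simp only [entry_mul_entry_same] at hxyx hyxy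
    rw [(hi s).2 t (entry_inj hs hxyx.symm).2.1.symm (entry_inj ht hyxy.symm).2.1.symm]

/-- The coordinate of an element at the position `(α, β)`. -/
noncomputable def coord (α β : lam) : BrandtCarrier lam S → S
  | .zero => 0
  | .elt γ s δ =>
    letI := Classical.propDecidable (γ = α ∧ δ = β)
    if γ = α ∧ δ = β then s else 0

@[simp]
theorem coord_zero (α β : lam) : coord α β (zero : BrandtCarrier lam S) = 0 := rfl

open Classical in
theorem coord_entry (α β γ δ : lam) (s : S) :
    coord α β (entry γ s δ) = if γ = α ∧ δ = β then s else 0 := by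
  by_cases hs : s = 0
  · simp [hs, coord]
  · simp [entry_of_ne _ _ hs, coord]

@[simp]
theorem coord_entry_same (α β : lam) (s : S) : coord α β (entry α s β) = s := by
  simp [coord_entry]

theorem ext_coord {x y : BrandtCarrier lam S} (h : ∀ α β, coord α β x = coord α β y) :
    x = y := by
  obtain rfl | ⟨α, s, β, hs, rfl⟩ := eq_zero_or_entry x
  · obtain rfl | ⟨γ, t, δ, ht, rfl⟩ := eq_zero_or_entry y
    · rfl
    · exact absurd (by simpa using (h γ δ).symm) ht
  · have hαβ := h α β
    obtain rfl | ⟨γ, t, δ, ht, rfl⟩ := eq_zero_or_entry y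
    · exact absurd (by simpa using hαβ) hs
    · rw [coord_entry_same, coord_entry] at hαβ
      split_ifs at hαβ with hpos
      · rw [hpos.1, hpos.2, hαβ]
      · exact absurd hαβ hs

/-- The map `(α, s, β) ↦ (α, f s, β)` between Brandt extensions. -/
noncomputable def map {C : Type u} [MonoidWithZero C] (f : S → C) :
    BrandtCarrier lam S → BrandtCarrier lam C
  | .zero => .zero
  | .elt α s β => entry α (f s) β

@[simp]
theorem map_zero {C : Type u} [MonoidWithZero C] (f : S → C) :
    map f (zero : BrandtCarrier lam S) = zero := rfl

theorem map_entry {C : Type u} [MonoidWithZero C] {f : S → C} (h0 : f 0 = 0) (α β : lam)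
    (s : S) : map f (entry α s β) = entry α (f s) β := by
  by_cases hs : s = 0
  · simp [hs, h0, map]
  · simp [entry_of_ne α β hs, map]

theorem map_mul {C : Type u} [MonoidWithZero C] {f : S → C} (h0 : f 0 = 0)
    (hf : ∀ s t, f (s * t) = f s * f t) (x y : BrandtCarrier lam S) :
    map f (x * y) = map f x * map f y := by
  obtain rfl | ⟨α, s, β, -, rfl⟩ := eq_zero_or_entry x
  · simp
  obtain rfl | ⟨γ, t, δ, -, rfl⟩ := eq_zero_or_entry y
  · simp
  by_cases h : β = γ
  · subst h
    simp [map_entry h0, hf]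
  · simp [map_entry h0, entry_mul_entry_of_ne h]

section FineTopology

variable [TopologicalSpace S]

/-- The finest topology on the Brandt extension making all inclusions
`s ↦ (α, s, β)` continuous. -/
noncomputable abbrev fineTopology : TopologicalSpace (BrandtCarrier lam S) :=
  ⨆ p : lam × lam, TopologicalSpace.coinduced (fun s => entry p.1 s p.2) inferInstance

attribute [local instance] fineTopology

theorem continuous_entry (α β : lam) :
    Continuous (fun s : S => (entry α s β : BrandtCarrier lam S)) :=
  continuous_iSup_rng (i := (α, β)) continuous_coinduced_rng

theorem continuous_of_entry {X : Type*} [TopologicalSpace X] {f : BrandtCarrier lam S → X}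
    (hf : ∀ α β, Continuous fun s => f (entry α s β)) : Continuous f :=
  continuous_iSup_dom.2 fun p => continuous_coinduced_dom.2 (hf p.1 p.2)

theorem continuous_coord (α β : lam) :
    Continuous (coord α β : BrandtCarrier lam S → S) := by
  refine continuous_of_entry fun γ δ => ?_
  by_cases h : γ = α ∧ δ = β
  · simpa [coord_entry, h] using continuous_id'
  · simpa only [coord_entry, h, if_false] using continuous_const

theorem isSTISWCI_fineTopology {i : S → S} (hS : IsSTISWCI i) :
    IsSTISWCI (inversion i : BrandtCarrier lam S → BrandtCarrier lam S) := by
  obtain ⟨⟨-, hT2, hl, hr⟩, hi, hic⟩ := hS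
  refine ⟨⟨mul_assoc', ?_, fun x => ?_, fun x => ?_⟩, isInvOf_inversion hi, ?_⟩
  · refine ⟨fun x y hxy => ?_⟩
    obtain ⟨α, β, h⟩ : ∃ α β, coord α β x ≠ coord α β y := by
      by_contra! h
      exact hxy (ext_coord h)
    exact separated_by_continuous (continuous_coord α β) h
  · refine continuous_of_entry fun γ δ => ?_
    obtain rfl | ⟨α, s, β, -, rfl⟩ := eq_zero_or_entry x
    · simpa using continuous_const
    by_cases h : β = γ
    · subst h
      simpa using (continuous_entry α δ).comp' (hl s)
    · simpa [entry_mul_entry_of_ne h] using continuous_const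
  · refine continuous_of_entry fun γ δ => ?_
    obtain rfl | ⟨α, s, β, -, rfl⟩ := eq_zero_or_entry x
    · simpa using continuous_const
    by_cases h : δ = α
    · subst h
      simpa using (continuous_entry γ β).comp' (hr s)
    · simpa [entry_mul_entry_of_ne h] using continuous_const
  · refine continuous_of_entry fun α β => ?_
    simpa [inversion_entry hi] using (continuous_entry β α).comp' hic

theorem isTopBrandtExt_fineTopology {i : S → S} (hS : IsSTISWCI i) (α : lam) :
    IsTopBrandtExt (fineTopology : TopologicalSpace (BrandtCarrier lam S)) (inversion i) :=
  ⟨isSTISWCI_fineTopology hS, α, .of_leftInverse (f := coord α α)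
    (fun s => coord_entry_same α α s) (continuous_coord α α) (continuous_entry α α)⟩

theorem continuous_map {C : Type u} [MonoidWithZero C] [TopologicalSpace C] {f : S → C}
    (h0 : f 0 = 0) (hf : Continuous f) :
    Continuous (map f : BrandtCarrier lam S → BrandtCarrier lam C) :=
  continuous_of_entry fun α β => by
    simpa [map_entry h0] using (continuous_entry α β).comp' hf

/-- Absolute `H`-closedness of the finest topological Brandt extension forces a homomorphism
from `S` to a monoid with zero in the class to have closed range, as soon as it preserves zero. -/
theorem isClosed_range_of_absHClosed (α : lam)
    (hB : AbsHClosedSTIS (BrandtCarrier lam S)) {C : Type u} [MonoidWithZero C]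
    [TopologicalSpace C] {iC : C → C} (hC : IsSTISWCI iC) {f : S → C} (h0 : f 0 = 0)
    (hf : Continuous f) (hmul : ∀ s t, f (s * t) = f s * f t) : IsClosed (Set.range f) := by
  have hcl := (hB (BrandtCarrier lam C) (inversion iC) (isSTISWCI_fineTopology hC) (map f)
    (continuous_map h0 hf) (map_mul h0 hmul)).preimage (continuous_entry α α)
  convert hcl using 1
  ext c
  constructor
  · rintro ⟨s, rfl⟩
    exact ⟨entry α s α, map_entry h0 α α s⟩
  · rintro ⟨x, hx⟩
    by_cases hc : c = 0
    · exact ⟨0, by rw [h0, hc]⟩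
    obtain rfl | ⟨γ, s, δ, -, rfl⟩ := eq_zero_or_entry x
    · exact absurd (entry_eq_zero.1 hx.symm) hc
    · rw [map_entry h0] at hx
      exact ⟨s, (entry_inj hc hx.symm).2.1.symm⟩

end FineTopology

end BrandtCarrier

section ClosureOfImage

variable {S T : Type u} [Mul S] [Mul T] {iT : T → T} {h : S → T}

theorem IsInvOf.map_inv {iS : S → S} (hS : IsInvOf iS) (hT : IsInvOf iT)
    (hm : ∀ x y, h (x * y) = h x * h y) (x : S) : iT (h x) = h (iS x) := by
  refine ((hT (h x)).2 _ ?_ ?_).symm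
  · rw [← hm, ← hm, (hS x).1.1]
  · rw [← hm, ← hm, (hS x).1.2]

variable [TopologicalSpace T]

theorem mem_closure_range_inv {iS : S → S} (hS : IsInvOf iS) (hT : IsSTISWCI iT)
    (hm : ∀ x y, h (x * y) = h x * h y) {t : T} (ht : t ∈ closure (Set.range h)) :
    iT t ∈ closure (Set.range h) := by
  refine map_mem_closure hT.2.2 ht ?_
  rintro _ ⟨x, rfl⟩
  exact ⟨iS x, (hS.map_inv hT.2.1 hm x).symm⟩

theorem mul_mem_closure_range (hT : IsSemitopologicalSemigroup T)
    (hm : ∀ x y, h (x * y) = h x * h y) {s t : T} (hs : s ∈ closure (Set.range h))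
    (ht : t ∈ closure (Set.range h)) : s * t ∈ closure (Set.range h) := by
  obtain ⟨-, -, hl, hr⟩ := hT
  have key : ∀ x, h x * t ∈ closure (Set.range h) := fun x => by
    refine map_mem_closure (hl (h x)) ht ?_
    rintro _ ⟨y, rfl⟩
    exact ⟨x * y, hm x y⟩
  refine closure_minimal (t := {s | s * t ∈ closure (Set.range h)}) ?_
    (isClosed_closure.preimage (hr t)) hs
  rintro _ ⟨x, rfl⟩
  exact key x

end ClosureOfImage

theorem AbsHClosedSTIS.of_brandt {S lam : Type u} [MonoidWithZero S] [TopologicalSpace S]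
    {iS : S → S} (hS : IsSTISWCI iS) (α : lam)
    (hB : @AbsHClosedSTIS (BrandtCarrier lam S) _ BrandtCarrier.fineTopology) :
    AbsHClosedSTIS S := by
  intro T _ _ iT hT h hc hm
  have hT2 : T2Space T := hT.1.2.1
  let C := closure (Set.range h)
  have hmem : ∀ s, h s ∈ C := fun s => subset_closure ⟨s, rfl⟩
  have hCT {f g : T → T} (hf : Continuous f) (hg : Continuous g)
      (hfg : ∀ s, f (h s) = g (h s)) (c : C) : f c = g c :=
    closure_minimal (t := {t | f t = g t}) (by rintro _ ⟨s, rfl⟩; exact hfg s)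
      (isClosed_eq hf hg) c.2
  let _ : MonoidWithZero C :=
    { mul := fun x y => ⟨x * y, mul_mem_closure_range hT.1 hm x.2 y.2⟩
      one := ⟨h 1, hmem 1⟩
      zero := ⟨h 0, hmem 0⟩
      mul_assoc := fun x y z => Subtype.ext (hT.1.1 x y z)
      one_mul := fun x => Subtype.ext
        (hCT (hT.1.2.2.1 _) continuous_id (fun s => (hm 1 s).symm.trans (by rw [one_mul]; rfl)) x)
      mul_one := fun x => Subtype.ext
        (hCT (hT.1.2.2.2 _) continuous_id (fun s => (hm s 1).symm.trans (by rw [mul_one]; rfl)) x)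
      zero_mul := fun x => Subtype.ext
        (hCT (hT.1.2.2.1 _) continuous_const (fun s => (hm 0 s).symm.trans (by rw [zero_mul]; rfl)) x)
      mul_zero := fun x => Subtype.ext
        (hCT (hT.1.2.2.2 _) continuous_const (fun s => (hm s 0).symm.trans (by rw [mul_zero]; rfl)) x) }
  have hC : IsSTISWCI fun x : C => (⟨iT x, mem_closure_range_inv hS.2.1 hT hm x.2⟩ : C) :=
    ⟨⟨mul_assoc, inferInstance,
      fun a => ((hT.1.2.2.1 a).comp continuous_subtype_val).subtype_mk _,
      fun a => ((hT.1.2.2.2 a).comp continuous_subtype_val).subtype_mk _⟩,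
      fun x => ⟨⟨Subtype.ext (hT.2.1 x).1.1, Subtype.ext (hT.2.1 x).1.2⟩, fun y h₁ h₂ =>
        Subtype.ext ((hT.2.1 x).2 y (congrArg Subtype.val h₁) (congrArg Subtype.val h₂))⟩,
      (hT.2.2.comp continuous_subtype_val).subtype_mk _⟩
  have hcl := BrandtCarrier.isClosed_range_of_absHClosed α hB hC
    (f := fun s => (⟨h s, hmem s⟩ : C)) rfl (hc.subtype_mk _) (fun s t => Subtype.ext (hm s t))
  have := hcl.trans isClosed_closure
  convert this using 1
  ext t
  simp

theorem AbsHClosedSTIS.brandt {S lam : Type u} [MonoidWithZero S] [TopologicalSpace S]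
    (hS : AbsHClosedSTIS S) [TopologicalSpace (BrandtCarrier lam S)]
    {iB : BrandtCarrier lam S → BrandtCarrier lam S} (hB : IsSTISWCI iB) {a : lam}
    (ha : Continuous (brandtEmb (lam := lam) (S := S) a)) :
    AbsHClosedSTIS (BrandtCarrier lam S) := by
  intro T _ _ iT hT h hc hm
  have hT2 : T2Space T := hT.1.2.1
  obtain ⟨hassoc, -, hl, hr⟩ := hT.1
  let z : T := h .zero
  let e : lam → T := fun β => h (.entry β 1 β)
  let C := closure (Set.range h)
  have hzC {g : T → T} (hg : Continuous g) (hgz : ∀ x, g (h x) = z) {t : T} (ht : t ∈ C) :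
      g t = z :=
    closure_minimal (t := {t | g t = z}) (by rintro _ ⟨x, rfl⟩; exact hgz x)
      (isClosed_eq hg continuous_const) ht
  have hmulz {t : T} (ht : t ∈ C) : t * z = z :=
    hzC (hr z) (fun x => by simp only [z, ← hm, BrandtCarrier.mul_zero']) ht
  have hzmul {t : T} (ht : t ∈ C) : z * t = z :=
    hzC (hl z) (fun x => by simp only [z, ← hm, BrandtCarrier.zero_mul']) ht
  have hhC (x : BrandtCarrier lam S) : h x ∈ C := subset_closure ⟨x, rfl⟩
  have hcorner : IsClosed (Set.range fun s => h (brandtEmb a s)) :=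
    hS T iT hT _ (hc.comp ha) fun s t => by
      simp only [← hm, BrandtCarrier.brandtEmb_eq_entry, BrandtCarrier.entry_mul_entry_same]
  have hmid {t : T} (ht : t ∈ C) (β γ : lam) : e β * t * e γ ∈ Set.range h := by
    obtain ⟨s, hs⟩ : h (.entry a 1 β) * t * h (.entry γ 1 a) ∈
        Set.range fun s => h (brandtEmb a s) := by
      refine closure_minimal (t := {t | h (.entry a 1 β) * t * h (.entry γ 1 a) ∈
        Set.range fun s => h (brandtEmb a s)}) ?_
        (hcorner.preimage ((hr _).comp (hl _))) ht
      rintro _ ⟨x, rfl⟩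
      simp only [Set.mem_ofPred_eq, ← hm, BrandtCarrier.brandtEmb_eq_entry]
      obtain rfl | ⟨μ, s, ν, -, rfl⟩ := BrandtCarrier.eq_zero_or_entry x
      · exact ⟨0, by simp⟩
      by_cases h₁ : β = μ
      · by_cases h₂ : ν = γ
        · subst h₁ h₂
          exact ⟨s, by simp⟩
        · exact ⟨0, by simp [hB.1.1, BrandtCarrier.entry_mul_entry_of_ne h₂]⟩
      · exact ⟨0, by simp [BrandtCarrier.entry_mul_entry_of_ne h₁]⟩
    have he : e β * t * e γ =
        h (.entry β 1 a) * (h (.entry a 1 β) * t * h (.entry γ 1 a)) * h (.entry a 1 γ) := by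
      have h₁ : e β = h (.entry β 1 a) * h (.entry a 1 β) := by simp [e, ← hm]
      have h₂ : e γ = h (.entry γ 1 a) * h (.entry a 1 γ) := by simp [e, ← hm]
      simp only [h₁, h₂, hassoc]
    rw [he, ← hs]
    exact ⟨.entry β 1 a * brandtEmb a s * .entry a 1 γ, by rw [hm, hm]⟩
  refine isClosed_of_closure_subset fun t ht => ?_
  by_cases htz : t = z
  · exact ⟨_, htz.symm⟩
  have hi : iT t ∈ C := mem_closure_range_inv hB.2.1 hT hm ht
  have hti : t * iT t * t = t := (hT.2.1 t).1.1
  obtain ⟨γ, hγ⟩ : ∃ γ, t * e γ ≠ z := by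
    by_contra! H
    have hz : t * iT t = z := by
      refine hzC (hl t) (fun x => ?_) hi
      obtain rfl | ⟨γ, s, δ, -, rfl⟩ := BrandtCarrier.eq_zero_or_entry x
      · exact hmulz ht
      · have hx : h (.entry γ s δ) = e γ * h (.entry γ s δ) := by simp [e, ← hm]
        rw [hx, ← hassoc, H, hzmul (hhC _)]
    rw [hz, hzmul ht] at hti
    exact htz hti.symm
  obtain ⟨β, hβ⟩ : ∃ β, e β * t * e γ ≠ z := by
    by_contra! H
    have hz : iT t * (t * e γ) = z := by
      refine hzC (hr (t * e γ)) (fun x => ?_) hi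
      obtain rfl | ⟨α, s, β, -, rfl⟩ := BrandtCarrier.eq_zero_or_entry x
      · rw [← hassoc, hzmul ht, hzmul (hhC _)]
      · have hx : h (.entry α s β) = h (.entry α s β) * e β := by simp [e, ← hm]
        rw [hx, hassoc, ← hassoc (e β), H, hmulz (hhC _)]
    refine hγ ?_
    rw [← hti, hassoc, hassoc, hz, hmulz ht]
  have hβγ : e β * t * e γ = t := by
    have hclosed : IsClosed {x | e β * x * e γ = z ∨ e β * x * e γ = x} :=
      (isClosed_eq ((hr _).comp (hl _)) continuous_const).union
        (isClosed_eq ((hr _).comp (hl _)) continuous_id)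
    refine (closure_minimal ?_ hclosed ht).resolve_left hβ
    rintro _ ⟨x, rfl⟩
    simp only [Set.mem_ofPred_eq, e, z, ← hm]
    obtain rfl | ⟨μ, s, ν, -, rfl⟩ := BrandtCarrier.eq_zero_or_entry x
    · simp
    by_cases h₁ : β = μ
    · by_cases h₂ : ν = γ
      · subst h₁ h₂
        simp
      · simp [hB.1.1, BrandtCarrier.entry_mul_entry_of_ne h₂]
    · simp [BrandtCarrier.entry_mul_entry_of_ne h₁]
  rw [← hβγ]
  exact hmid ht β γ

/-- A Hausdorff semitopological inverse monoid with zero and continuous inversion is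
absolutely `H`-closed in the class of semitopological inverse semigroups with
continuous inversion iff for some (equivalently, for every) cardinal `λ ≥ 2` every
topological Brandt `λ⁰`-extension of `S` in this class is absolutely `H`-closed in
this class. -/
theorem stmt16 {S : Type u} [MonoidWithZero S] [TopologicalSpace S]
    (iS : S → S) (hS : IsSTISWCI iS) :
    (AbsHClosedSTIS S ↔
        ∃ lam : Type u, 2 ≤ Cardinal.mk lam ∧
          ∀ (tB : TopologicalSpace (BrandtCarrier lam S))
            (iB : BrandtCarrier lam S → BrandtCarrier lam S),
            IsTopBrandtExt tB iB → @AbsHClosedSTIS (BrandtCarrier lam S) _ tB) ∧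
      (AbsHClosedSTIS S ↔
        ∀ lam : Type u, 2 ≤ Cardinal.mk lam →
          ∀ (tB : TopologicalSpace (BrandtCarrier lam S))
            (iB : BrandtCarrier lam S → BrandtCarrier lam S),
            IsTopBrandtExt tB iB → @AbsHClosedSTIS (BrandtCarrier lam S) _ tB) := by
  have hfwd (hH : AbsHClosedSTIS S) (lam : Type u)
      (tB : TopologicalSpace (BrandtCarrier lam S))
      (iB : BrandtCarrier lam S → BrandtCarrier lam S) (hB : IsTopBrandtExt tB iB) :
      @AbsHClosedSTIS (BrandtCarrier lam S) _ tB := by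
    obtain ⟨hB, a, ha⟩ := hB
    exact hH.brandt hB ha.continuous
  have hbwd (lam : Type u) (hlam : 2 ≤ Cardinal.mk lam)
      (H : ∀ (tB : TopologicalSpace (BrandtCarrier lam S))
        (iB : BrandtCarrier lam S → BrandtCarrier lam S),
        IsTopBrandtExt tB iB → @AbsHClosedSTIS (BrandtCarrier lam S) _ tB) :
      AbsHClosedSTIS S := by
    obtain ⟨α⟩ : Nonempty lam :=
      Cardinal.mk_ne_zero_iff.1 fun h0 => by simp [h0] at hlam
    exact .of_brandt hS α (H _ _ (BrandtCarrier.isTopBrandtExt_fineTopology hS α))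
  have htwo : 2 ≤ Cardinal.mk (ULift.{u} (Fin 2)) := by simp
  exact ⟨⟨fun hH => ⟨_, htwo, hfwd hH _⟩, fun ⟨lam, hlam, H⟩ => hbwd lam hlam H⟩,
    fun hH lam _ => hfwd hH lam, fun H => hbwd _ htwo (H _ htwo)⟩
end

section
/- Let S be a semitopological inverse semigroup with continuous inversion such that S = ⋃_{α∈A} S_α, where (i) each S_α, with the subspace topology and induced operation, is an inverse subsemigroup of S which is absolutely H-closed in the class of semitopological inverse semigroups with continuous inversion, and (ii) there exists a two-sided ideal T of S which is an inverse subsemigroup absolutely H-closed in the class of semitopological inverse semigroups with continuous inversion and which satisfies S_α · S_β ⊆ T for all α ≠ β in A. Then S is absolutely H-closed in the class of semitopological inverse semigroups with continuous inversion. -/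
open Topology

universe u v

/-- A subset `A` of `S`, with the subspace topology and the induced operation, is
absolutely `H`-closed in the class of semitopological inverse semigroups with
continuous inversion. -/
def AbsHClosedSubsetSTIS {S : Type u} [Mul S] [TopologicalSpace S] (A : Set S) :
    Prop :=
  ∀ (T : Type u) [Mul T] [TopologicalSpace T] (iT : T → T), IsSTISWCI iT →
    ∀ h : A → T, Continuous h →
      (∀ (x y : A) (hxy : (x : S) * (y : S) ∈ A),
        h ⟨(x : S) * (y : S), hxy⟩ = h x * h y) →
      IsClosed (Set.range h)

/-- A subset `A` of `S`, with the subspace topology and the induced operation, is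
`H`-closed in the class of semitopological inverse semigroups with continuous
inversion. -/
def HClosedSubsetSTIS {S : Type u} [Mul S] [TopologicalSpace S] (A : Set S) : Prop :=
  ∀ (T : Type u) [Mul T] [TopologicalSpace T] (iT : T → T), IsSTISWCI iT →
    ∀ h : A → T,
      (∀ (x y : A) (hxy : (x : S) * (y : S) ∈ A),
        h ⟨(x : S) * (y : S), hxy⟩ = h x * h y) →
      IsEmbedding h → IsClosed (Set.range h)

/-- The image of an absolutely `H`-closed subset under a continuous homomorphism is closed. -/
theorem AbsHClosedSubsetSTIS.isClosed_image {S : Type u} [Mul S] [TopologicalSpace S]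
    {A : Set S} (hA : AbsHClosedSubsetSTIS A) {G : Type u} [Mul G] [TopologicalSpace G]
    {iG : G → G} (hG : IsSTISWCI iG) {h : S → G} (hc : Continuous h)
    (hm : ∀ x y : S, h (x * y) = h x * h y) : IsClosed (h '' A) := by
  have := hA G iG hG (fun a => h a) (hc.comp continuous_subtype_val) fun x y _ => hm x y
  rwa [Set.image_eq_range]

/-- A multiplicative map between inverse semigroups commutes with the inversion maps. -/
theorem IsInvOf.map_inv_s18 {S : Type u} {G : Type v} [Mul S] [Mul G] {i : S → S} {iG : G → G}
    (hi : IsInvOf i) (hiG : IsInvOf iG) {h : S → G}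
    (hm : ∀ x y : S, h (x * y) = h x * h y) (s : S) : h (i s) = iG (h s) := by
  apply (hiG (h s)).2
  · rw [← hm, ← hm, (hi s).1.1]
  · rw [← hm, ← hm, (hi s).1.2]

/-- If a semitopological inverse semigroup with continuous inversion is a union of
absolutely `H`-closed inverse subsemigroups whose pairwise products lie in an
absolutely `H`-closed ideal, then it is absolutely `H`-closed in the class of
semitopological inverse semigroups with continuous inversion. -/
theorem stmt18 {S : Type u} [Mul S] [TopologicalSpace S]
    (i : S → S) (hS : IsSTISWCI i)
    {ι : Type v} (Sfam : ι → Set S) (hcover : (⋃ α, Sfam α) = Set.univ)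
    (hsubmul : ∀ α, ∀ x ∈ Sfam α, ∀ y ∈ Sfam α, x * y ∈ Sfam α)
    (hsubinv : ∀ α, ∀ x ∈ Sfam α, i x ∈ Sfam α)
    (habs : ∀ α, AbsHClosedSubsetSTIS (Sfam α))
    (Tid : Set S)
    (hideal : ∀ x : S, ∀ t ∈ Tid, x * t ∈ Tid ∧ t * x ∈ Tid)
    (hTinv : ∀ t ∈ Tid, i t ∈ Tid)
    (hTabs : AbsHClosedSubsetSTIS Tid)
    (hprod : ∀ α β, α ≠ β → ∀ x ∈ Sfam α, ∀ y ∈ Sfam β, x * y ∈ Tid) :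
    AbsHClosedSTIS S := by
  intro G _ _ iG hG h hc hm
  obtain ⟨⟨hassoc, -, hleft, hright⟩, hinv, hicont⟩ := id hG
  have hK : IsClosed (h '' Tid) := hTabs.isClosed_image hG hc hm
  refine isClosed_of_closure_subset fun x hx => ?_
  by_contra hxD
  have mul_mem : ∀ s, h s * x ∈ h '' Tid := by
    intro s
    obtain ⟨α, hα⟩ := Set.mem_iUnion.1 (hcover.symm ▸ Set.mem_univ s)
    have hDα : IsClosed (h '' Sfam α) := (habs α).isClosed_image hG hc hm
    have hxα : x ∈ (h '' Sfam α)ᶜ := fun hmem => hxD (Set.image_subset_range _ _ hmem)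
    have hx' : x ∈ closure ((h '' Sfam α)ᶜ ∩ Set.range h) :=
      hDα.isOpen_compl.inter_closure ⟨hxα, hx⟩
    refine hK.closure_subset (map_mem_closure (hleft (h s)) hx' ?_)
    rintro _ ⟨hy, t, rfl⟩
    obtain ⟨β, hβ⟩ := Set.mem_iUnion.1 (hcover.symm ▸ Set.mem_univ t)
    have hne : α ≠ β := by
      rintro rfl
      exact hy ⟨t, hβ, rfl⟩
    exact ⟨s * t, hprod α β hne s hα t hβ, hm s t⟩
  have hix : iG x ∈ closure (Set.range h) := by
    refine map_mem_closure hicont hx ?_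
    rintro _ ⟨s, rfl⟩
    exact ⟨i s, hS.2.1.map_inv_s18 hinv hm s⟩
  obtain ⟨t, ht, hte⟩ : iG x * x ∈ h '' Tid := by
    refine hK.closure_subset (map_mem_closure (f := fun y => y * x) (hright x) hix ?_)
    rintro _ ⟨s, rfl⟩
    exact mul_mem s
  have hxe : x * (iG x * x) ∈ h '' Tid := by
    refine hK.closure_subset
      (map_mem_closure (f := fun y => y * (iG x * x)) (hright (iG x * x)) hx ?_)
    rintro _ ⟨s, rfl⟩
    exact ⟨s * t, (hideal s t ht).1, by rw [hm, hte]⟩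
  rw [← hassoc, (hinv x).1.1] at hxe
  exact hxD (Set.image_subset_range _ _ hxe)
end
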